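/- arXiv:2402.12879 — 2 statements merged into one kernel-verified Lean document; each statement's English description precedes it below -/
import Mathlib

section
/- Let R be a commutative ring, A an R-algebra, I ⊂ A an ideal such that (A, I) is a Henselian pair, and X a smooth affine R-scheme. Then the canonical map X(A) → X(A/I) on R-points is surjective. -/
universe u

open KaehlerDifferential in
/-- If `B` is the sum of the image of `A` and an ideal `J`, and `Ω[B⁄A]` is projective, there is a
linear map `l : Ω[B⁄A] → B` with values in `J` such that the differential of `l ω` is `ω`
modulo `J`. -/
theorem KaehlerDifferential.exists_linearMap_sub_mem_smul_top
    {A B : Type*} [CommRing A] [CommRing B] [Algebra A B] [Module.Projective B (Ω[B⁄A])]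
    (J : Ideal B) (hJ : ∀ b : B, ∃ a : A, b - algebraMap A B a ∈ J) :
    ∃ l : Ω[B⁄A] →ₗ[B] B, ∀ ω, l ω ∈ J ∧ D A B (l ω) - ω ∈ J • (⊤ : Submodule B (Ω[B⁄A])) := by
  let p : (J →₀ B) →ₗ[B] Ω[B⁄A] := Finsupp.linearCombination B fun j : J ↦ D A B j
  have hp : Function.Surjective p := by
    rw [← LinearMap.range_eq_top, ← top_le_iff, ← span_range_derivation, Submodule.span_le]
    rintro _ ⟨b, rfl⟩
    obtain ⟨a, ha⟩ := hJ b
    exact ⟨Finsupp.single ⟨_, ha⟩ 1, by simp [p]⟩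
  obtain ⟨s, hs⟩ := Module.projective_lifting_property p LinearMap.id hp
  let q : (J →₀ B) →ₗ[B] B := Finsupp.linearCombination B fun j : J ↦ (j : B)
  have hq (v : J →₀ B) : q v ∈ J ∧ D A B (q v) - p v ∈ J • (⊤ : Submodule B (Ω[B⁄A])) := by
    induction v using Finsupp.induction_linear with
    | zero => simp
    | add v w hv hw =>
      simp only [map_add]
      refine ⟨add_mem hv.1 hw.1, ?_⟩
      rw [add_sub_add_comm]
      exact add_mem hv.2 hw.2
    | single j b =>
      simp only [q, p, Finsupp.linearCombination_single, smul_eq_mul, Derivation.leibniz,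
        add_sub_cancel_left]
      exact ⟨J.mul_mem_left _ j.2, Submodule.smul_mem_smul j.2 trivial⟩
  refine ⟨q ∘ₗ s, fun ω ↦ ?_⟩
  have := hq (s ω)
  rwa [show p (s ω) = ω from LinearMap.congr_fun hs ω] at this

/-- If `A → B ⧸ L` is surjective, then `B ⧸ L` is the quotient of `A` by the preimage of `L`. -/
theorem Ideal.exists_algHom_quotient_comap
    {A B : Type*} [CommRing A] [CommRing B] [Algebra A B] (L : Ideal B)
    (hB : ∀ b : B, ∃ a : A, b - algebraMap A B a ∈ L) :
    ∃ ψ : B →ₐ[A] A ⧸ L.comap (algebraMap A B), ∀ x ∈ L, ψ x = 0 := by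
  have hsurj : Function.Surjective (Algebra.ofId A (B ⧸ L)) := fun x ↦ by
    obtain ⟨b, rfl⟩ := Ideal.Quotient.mk_surjective x
    obtain ⟨a, ha⟩ := hB b
    exact ⟨a, (Ideal.Quotient.eq.mpr ha).symm⟩
  have hker : RingHom.ker (Algebra.ofId A (B ⧸ L)) = L.comap (algebraMap A B) := by
    ext a
    exact Ideal.Quotient.eq_zero_iff_mem
  let e := (Ideal.quotientEquivAlgOfEq A hker.symm).trans
    (Ideal.quotientKerAlgEquivOfSurjective hsurj)
  refine ⟨e.symm.toAlgHom.comp (Ideal.Quotient.mkₐ A L), fun x hx ↦ ?_⟩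
  rw [AlgHom.comp_apply, Ideal.Quotient.mkₐ_eq_mk, Ideal.Quotient.eq_zero_iff_mem.mpr hx, map_zero]

open KaehlerDifferential in
/-- Let `B` be formally smooth over `A` and `L` an ideal such that `A → B ⧸ L` is surjective. If
`L` is generated modulo `L ^ 2` by the image of a linear map `Ω[B⁄A] → B`, then the kernel of
`A → B ⧸ L` is idempotent. -/
theorem Ideal.comap_algebraMap_le_sq_of_le_range_sup_sq
    {A B : Type*} [CommRing A] [CommRing B] [Algebra A B] [Algebra.FormallySmooth A B]
    [Module.Finite B (Ω[B⁄A])] (L : Ideal B) (l : Ω[B⁄A] →ₗ[B] B)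
    (hl : l.range ≤ L) (hL : L ≤ l.range ⊔ L ^ 2) (hB : ∀ b : B, ∃ a : A, b - algebraMap A B a ∈ L) :
    L.comap (algebraMap A B) ≤ L.comap (algebraMap A B) ^ 2 := by
  set 𝔨 := L.comap (algebraMap A B) with h𝔨
  let N : Submodule B (Ω[B⁄A]) := L • ⊤
  have hDsq (x : B) (hx : x ∈ L ^ 2) : D A B x ∈ N := by
    rw [pow_two] at hx
    induction hx using Submodule.mul_induction_on' with
    | mem_mul_mem x hx y hy =>
      rw [Derivation.leibniz]
      exact add_mem (Submodule.smul_mem_smul hx trivial) (Submodule.smul_mem_smul hy trivial)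
    | add x _ y _ hx hy => simpa using add_mem hx hy
  let u' : Ω[B⁄A] →ₗ[B] Ω[B⁄A] ⧸ N :=
    { toFun := fun ω ↦ N.mkQ (D A B (l ω))
      map_add' := by simp
      map_smul' := fun b ω ↦ by
        simp only [map_smul, smul_eq_mul, Derivation.leibniz, map_add, RingHom.id_apply,
          add_eq_left]
        rw [← map_smul, Submodule.mkQ_apply, Submodule.Quotient.mk_eq_zero]
        exact Submodule.smul_mem_smul (hl ⟨_, rfl⟩) trivial }
  have hu' : N ≤ u'.ker := by
    refine Submodule.smul_le.mpr fun x hx ω _ ↦ ?_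
    rw [LinearMap.mem_ker, map_smul]
    obtain ⟨ω', hω'⟩ := N.mkQ_surjective (u' ω)
    rw [← hω', ← map_smul, Submodule.mkQ_apply, Submodule.Quotient.mk_eq_zero]
    exact Submodule.smul_mem_smul hx trivial
  let u : (Ω[B⁄A] ⧸ N) →ₗ[B] Ω[B⁄A] ⧸ N := N.liftQ u' hu'
  have hu : Function.Surjective u := by
    rw [← LinearMap.range_eq_top, Submodule.range_liftQ, ← top_le_iff, ← Submodule.range_mkQ N,
      LinearMap.range_eq_map, ← span_range_derivation, Submodule.map_span, Submodule.span_le]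
    rintro _ ⟨_, ⟨b, rfl⟩, rfl⟩
    obtain ⟨a, ha⟩ := hB b
    obtain ⟨_, ⟨ω, rfl⟩, z, hz, hyz⟩ := Submodule.mem_sup.mp (hL ha)
    refine ⟨ω, ?_⟩
    change N.mkQ (D A B (l ω)) = _
    rw [eq_sub_of_add_eq hyz, map_sub, map_sub, map_sub, Derivation.map_algebraMap, sub_zero,
      sub_eq_self, Submodule.mkQ_apply, Submodule.Quotient.mk_eq_zero]
    exact hDsq z hz
  have hu_inj := OrzechProperty.injective_of_surjective_endomorphism u hu
  have hsq (a : A) (ha : algebraMap A B a ∈ L) : algebraMap A B a ∈ L ^ 2 := by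
    obtain ⟨_, ⟨ω, rfl⟩, z, hz, hyz⟩ := Submodule.mem_sup.mp (hL ha)
    have hω : N.mkQ ω = 0 := by
      apply hu_inj
      rw [map_zero]
      change N.mkQ (D A B (l ω)) = 0
      rw [eq_sub_of_add_eq hyz, map_sub, Derivation.map_algebraMap, zero_sub, map_neg,
        neg_eq_zero, Submodule.mkQ_apply, Submodule.Quotient.mk_eq_zero]
      exact hDsq z hz
    rw [Submodule.mkQ_apply, Submodule.Quotient.mk_eq_zero] at hω
    rw [← hyz]
    refine add_mem ?_ hz
    have := Submodule.mem_map_of_mem (f := l) hω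
    rw [Submodule.map_smul'', Submodule.map_top] at this
    exact (smul_mono_right L hl).trans (by rw [pow_two, smul_eq_mul]) this
  obtain ⟨ψ, hψ⟩ := L.exists_algHom_quotient_comap hB
  let e := DoubleQuot.quotQuotEquivQuotOfLEₐ A (Ideal.pow_le_self (I := 𝔨) two_ne_zero)
  have hnil : (𝔨.map (Ideal.Quotient.mkₐ A (𝔨 ^ 2))) ^ 2 = ⊥ := by
    rw [← Ideal.map_pow]
    exact Ideal.map_quotient_self _
  obtain ⟨φ, hφ⟩ := Algebra.FormallySmooth.exists_lift _ ⟨2, hnil⟩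
    (e.symm.toAlgHom.comp ψ)
  have hφL : L ≤ (𝔨.map (Ideal.Quotient.mkₐ A (𝔨 ^ 2))).comap φ := fun x hx ↦ by
    have := DFunLike.congr_fun hφ x
    rw [AlgHom.comp_apply, AlgHom.comp_apply, hψ x hx, map_zero] at this
    exact (Ideal.Quotient.eq_zero_iff_mem (I := 𝔨.map (Ideal.Quotient.mkₐ A (𝔨 ^ 2)))).mp this
  intro a ha
  have := ((Ideal.pow_right_mono hφL 2).trans (Ideal.le_comap_pow _ 2)) (hsq a ha)
  rw [hnil, Ideal.mem_comap, AlgHom.commutes] at this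
  exact Ideal.Quotient.eq_zero_iff_mem.mp this

open KaehlerDifferential in
/-- If `l : Ω[B⁄A] → B` is such that the differential of `l ω` is `ω` modulo `J`, then some element
of `1 + J` annihilates the differentials of `B ⧸ l.range`. -/
theorem KaehlerDifferential.exists_sub_one_mem_and_smul_quotient_eq_zero
    {A B : Type*} [CommRing A] [CommRing B] [Algebra A B] [Module.Finite B (Ω[B⁄A])]
    (J : Ideal B) (l : Ω[B⁄A] →ₗ[B] B)
    (hl : ∀ ω, D A B (l ω) - ω ∈ J • (⊤ : Submodule B (Ω[B⁄A]))) :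
    ∃ g : B, g - 1 ∈ J ∧
      ∀ ω : Ω[(B ⧸ l.range)⁄A], Ideal.Quotient.mk l.range g • ω = 0 := by
  let f := KaehlerDifferential.map A A B (B ⧸ l.range)
  have hf : Function.Surjective f :=
    KaehlerDifferential.map_surjective_of_surjective A A B (B ⧸ l.range)
      Ideal.Quotient.mk_surjective
  have : Module.Finite B (Ω[(B ⧸ l.range)⁄A]) := .of_surjective f hf
  obtain ⟨g, hg, h⟩ := Submodule.exists_sub_one_mem_and_smul_eq_zero_of_fg_of_le_smul J
    (⊤ : Submodule B (Ω[(B ⧸ l.range)⁄A])) Module.Finite.fg_top <| by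
      rintro η -
      obtain ⟨ω, rfl⟩ := hf η
      have h := Submodule.mem_map_of_mem (f := f) (hl ω)
      rw [Submodule.map_smul'', map_sub] at h
      have h₀ : f (D A B (l ω)) = 0 := by
        rw [KaehlerDifferential.map_D, Ideal.Quotient.algebraMap_eq,
          Ideal.Quotient.eq_zero_iff_mem.mpr (l.mem_range_self ω), map_zero]
      rw [h₀, zero_sub, neg_mem_iff] at h
      exact Submodule.smul_mono le_rfl le_top h
  refine ⟨g, hg, fun ω ↦ ?_⟩
  rw [← Ideal.Quotient.algebraMap_eq, algebraMap_smul]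
  exact h ω trivial

/-- Zariski's main theorem around a section: if `g` annihilates the differentials of `D` and is
`1` on the section `σ`, there is an element `r` which is `1` on the section and some power of
which multiplies any given element of `D` into the integral closure of `A`. -/
theorem Algebra.exists_forall_isIntegral_pow_mul_of_smul_kaehlerDifferential_eq_zero
    {A D : Type*} [CommRing A] [CommRing D] [Algebra A D] [Algebra.FiniteType A D]
    {I : Ideal A} (σ : D →ₐ[A] A ⧸ I) (g : D) (hσg : σ g = 1) (hg : ∀ ω : Ω[D⁄A], g • ω = 0) :
    ∃ r : D, σ r = 1 ∧ ∀ x, ∃ m : ℕ, IsIntegral A (r ^ m * x) := by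
  let C := integralClosure A D
  have hint (r : D) (h : ∀ x, ∃ m : ℕ, IsIntegral A (r ^ m * x)) : IsIntegral A r := by
    obtain ⟨n, hn⟩ := h r
    rw [← pow_succ] at hn
    exact (IsIntegral.pow_iff (by simp)).mp hn
  let 𝔯 : Ideal C :=
    { carrier := {r | ∀ x, ∃ m : ℕ, IsIntegral A ((r : D) ^ m * x)}
      zero_mem' := fun x ↦ ⟨1, by simpa using isIntegral_zero⟩
      add_mem' := by
        intro r s hr hs x
        obtain ⟨m, hm⟩ := hr x
        obtain ⟨n, hn⟩ := hs x
        refine ⟨m + n, ?_⟩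
        rw [Subalgebra.coe_add, add_pow, Finset.sum_mul]
        refine IsIntegral.sum _ fun i hi ↦ ?_
        have hc : IsIntegral A (((m + n).choose i : ℕ) : D) := isIntegral_natCast _
        rcases le_total m i with h | h
        · obtain ⟨k, rfl⟩ := Nat.exists_eq_add_of_le h
          have := ((hm.mul (r.2.pow k)).mul (s.2.pow (m + n - (m + k)))).mul hc
          convert this using 1
          ring
        · obtain ⟨k, hk⟩ := Nat.exists_eq_add_of_le (show n ≤ m + n - i by omega)
          have := ((hn.mul (s.2.pow k)).mul (r.2.pow i)).mul hc
          rw [hk]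
          convert this using 1
          ring
      smul_mem' := by
        intro c r hr x
        obtain ⟨m, hm⟩ := hr x
        refine ⟨m, ?_⟩
        have := (c.2.pow m).mul hm
        rw [smul_eq_mul, Subalgebra.coe_mul, mul_pow, mul_assoc]
        exact this }
  let σ' : C →ₐ[A] A ⧸ I := σ.comp C.val
  have hσ' : Function.Surjective σ' := fun x ↦ by
    obtain ⟨a, rfl⟩ := Ideal.Quotient.mk_surjective x
    exact ⟨algebraMap A C a, σ'.commutes a⟩
  have htop : 𝔯.map σ' = ⊤ := by
    by_contra hne
    obtain ⟨M, hM, hle⟩ := Ideal.exists_le_maximal _ hne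
    have := hM.isPrime
    let p := M.comap σ
    have hgp : g ∉ p := fun h ↦ hM.ne_top <| (Ideal.eq_top_iff_one _).mpr <| by
      rw [← hσg]; exact h
    have hunr : Algebra.IsUnramifiedAt A p := by
      have : (⟨p, inferInstance⟩ : PrimeSpectrum D) ∈ Algebra.unramifiedLocus A D := by
        rw [Algebra.unramifiedLocus_eq_compl_support, Set.mem_compl_iff, Module.notMem_support_iff']
        exact fun ω ↦ ⟨g, hgp, hg ω⟩
      exact this
    have : Algebra.EssFiniteType A (Localization.AtPrime p) :=
      .comp A D _
    have : Algebra.QuasiFiniteAt A p :=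
      inferInstanceAs (Algebra.QuasiFinite A (Localization.AtPrime p))
    obtain ⟨r, hrp, hr⟩ := Algebra.zariskisMainProperty_iff'.mp
      (Algebra.ZariskisMainProperty.of_finiteType (R := A) p)
    exact hrp (hle (Ideal.mem_map_of_mem σ' (show (⟨r, hint r hr⟩ : C) ∈ 𝔯 from hr)))
  obtain ⟨r, hr, h1⟩ := (Ideal.mem_map_iff_of_surjective σ' hσ').mp
    (htop ▸ Submodule.mem_top : (1 : A ⧸ I) ∈ 𝔯.map σ')
  exact ⟨r, h1, hr⟩

/-- If all elements of `D` become integral after multiplication by powers of `r`, then a finite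
subalgebra containing `r` already contains such multiples of all elements of `D`. -/
theorem Algebra.exists_subalgebra_fg_forall_pow_mul_mem
    {A D : Type*} [CommRing A] [CommRing D] [Algebra A D] [Algebra.FiniteType A D]
    (r : D) (hr : ∀ x, ∃ m : ℕ, IsIntegral A (r ^ m * x)) :
    ∃ C : Subalgebra A D, C.toSubmodule.FG ∧ r ∈ C ∧ ∀ x, ∃ m : ℕ, r ^ m * x ∈ C := by
  have hint : IsIntegral A r := by
    obtain ⟨n, hn⟩ := hr r
    rw [← pow_succ] at hn
    exact (IsIntegral.pow_iff (by simp)).mp hn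
  obtain ⟨s, hs⟩ := Algebra.FiniteType.out (R := A) (A := D)
  choose m hm using hr
  let t := insert r ((fun x ↦ r ^ m x * x) '' (s : Set D))
  have hrt : r ∈ Algebra.adjoin A t := Algebra.subset_adjoin (Set.mem_insert _ _)
  refine ⟨Algebra.adjoin A t, fg_adjoin_of_finite ?_ ?_, hrt, fun x ↦ ?_⟩
  · exact (s.finite_toSet.image _).insert _
  · rintro a (rfl | ⟨x, hx, rfl⟩)
    exacts [hint, hm x]
  · have hx : x ∈ Algebra.adjoin A (s : Set D) := hs ▸ Algebra.mem_top
    induction hx using Algebra.adjoin_induction with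
    | mem x hx => exact ⟨m x, Algebra.subset_adjoin (Set.mem_insert_of_mem _ ⟨x, hx, rfl⟩)⟩
    | algebraMap a => exact ⟨0, by simp⟩
    | add x y _ _ hx hy =>
      obtain ⟨i, hi⟩ := hx
      obtain ⟨j, hj⟩ := hy
      refine ⟨i + j, ?_⟩
      convert add_mem (mul_mem (pow_mem hrt j) hi) (mul_mem (pow_mem hrt i) hj) using 1
      ring
    | mul x y _ _ hx hy =>
      obtain ⟨i, hi⟩ := hx
      obtain ⟨j, hj⟩ := hy
      refine ⟨i + j, ?_⟩
      convert mul_mem hi hj using 1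
      ring

/-- If `g` annihilates the differentials of `D` and is `1` on the section `σ`, then the section is
an open immersion modulo `I`. -/
theorem Algebra.exists_mul_ker_le_map_of_smul_kaehlerDifferential_eq_zero
    {A D : Type*} [CommRing A] [CommRing D] [Algebra A D] [Algebra.FiniteType A D]
    {I : Ideal A} (σ : D →ₐ[A] A ⧸ I) (g : D) (hσg : σ g = 1) (hg : ∀ ω : Ω[D⁄A], g • ω = 0) :
    ∃ e : D, σ e = 1 ∧ ∀ x, σ x = 0 → e * x ∈ I.map (algebraMap A D) := by
  let J := RingHom.ker σ
  let ID := I.map (algebraMap A D)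
  let Q := J ^ 2 ⊔ ID
  have hIJ : ID ≤ J := by
    rw [Ideal.map_le_iff_le_comap]
    intro a ha
    rw [Ideal.mem_comap, RingHom.mem_ker, AlgHom.commutes]
    exact Ideal.Quotient.eq_zero_iff_mem.mpr ha
  have hlift (x : D) : ∃ a : A, x - algebraMap A D a ∈ J := by
    obtain ⟨a, ha⟩ := Ideal.Quotient.mk_surjective (σ x)
    refine ⟨a, ?_⟩
    rw [RingHom.mem_ker, map_sub, AlgHom.commutes, ← ha, sub_eq_zero]
    rfl
  have hJQ : J ≤ Q := by
    let τ : (A ⧸ I) →ₐ[A] D ⧸ Q := Ideal.Quotient.liftₐ I (Algebra.ofId A (D ⧸ Q)) fun a ha ↦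
      Ideal.Quotient.eq_zero_iff_mem.mpr
        ((le_sup_right : ID ≤ Q) (Ideal.mem_map_of_mem (algebraMap A D) ha))
    let π := Ideal.Quotient.mkₐ A Q
    have hmem (x : D) : ∃ j ∈ J, π x - τ (σ x) = π j := by
      obtain ⟨a, ha⟩ := hlift x
      refine ⟨_, ha, ?_⟩
      rw [RingHom.mem_ker, map_sub, sub_eq_zero] at ha
      rw [ha, map_sub, AlgHom.commutes, AlgHom.commutes, AlgHom.commutes]
    have hzero (i j : D) (hi : i ∈ J) (hj : j ∈ J) : π i * π j = 0 := by
      rw [← map_mul]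
      exact Ideal.Quotient.eq_zero_iff_mem.mpr
        ((le_sup_left : J ^ 2 ≤ Q) (by rw [pow_two]; exact Ideal.mul_mem_mul hi hj))
    let δ : Derivation A D (D ⧸ Q) :=
      Derivation.mk' (π.toLinearMap - (τ.comp σ).toLinearMap) fun x y ↦ by
        obtain ⟨i, hi, hix⟩ := hmem x
        obtain ⟨j, hj, hjy⟩ := hmem y
        have h := hzero i j hi hj
        rw [← hix, ← hjy] at h
        simp only [LinearMap.sub_apply, AlgHom.toLinearMap_apply, AlgHom.comp_apply, map_mul,
          Algebra.smul_def]
        change _ = π x * _ + π y * _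
        linear_combination -h
    intro x hx
    have h1 : g • π x = 0 := by
      have := hg (KaehlerDifferential.D A D x)
      replace this := congr_arg δ.liftKaehlerDifferential this
      rw [map_smul, Derivation.liftKaehlerDifferential_comp_D, map_zero] at this
      rw [← this]
      change _ = g • (π x - τ (σ x))
      rw [show σ x = 0 from hx, map_zero, sub_zero]
    have h2 : π (1 - g) * π x = 0 := hzero _ _ (by simp [J, RingHom.mem_ker, hσg]) hx
    rw [Algebra.smul_def] at h1
    replace h1 : π g * π x = 0 := h1
    have : π x = 0 := by
      rw [map_sub, map_one] at h2
      linear_combination h1 + h2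
    exact Ideal.Quotient.eq_zero_iff_mem.mp this
  obtain ⟨s, hs⟩ := Algebra.FiniteType.out (R := A) (A := D)
  choose a ha using hlift
  let F : Ideal D := Ideal.span ((fun x ↦ x - algebraMap A D (a x)) '' (s : Set D))
  have hF : F ≤ J := Ideal.span_le.mpr (by rintro _ ⟨x, -, rfl⟩; exact ha x)
  have hJF : J ≤ F ⊔ ID := by
    have key (x : D) : ∃ b : A, x - algebraMap A D b ∈ F ⊔ ID := by
      have hx : x ∈ Algebra.adjoin A (s : Set D) := hs ▸ Algebra.mem_top
      induction hx using Algebra.adjoin_induction with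
      | mem x hx => exact ⟨a x, Ideal.mem_sup_left (Ideal.subset_span ⟨x, hx, rfl⟩)⟩
      | algebraMap b => exact ⟨b, by simp⟩
      | add x y _ _ hx hy =>
        obtain ⟨b, hb⟩ := hx
        obtain ⟨c, hc⟩ := hy
        refine ⟨b + c, ?_⟩
        convert add_mem hb hc using 1
        rw [map_add]; ring
      | mul x y _ _ hx hy =>
        obtain ⟨b, hb⟩ := hx
        obtain ⟨c, hc⟩ := hy
        refine ⟨b * c, ?_⟩
        convert add_mem (Ideal.mul_mem_left _ x hc)
          (Ideal.mul_mem_left _ (algebraMap A D c) hb) using 1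
        rw [map_mul]; ring
    intro x hx
    obtain ⟨b, hb⟩ := key x
    have h0 : x - algebraMap A D b ∈ J := (sup_le hF hIJ) hb
    have hbI : b ∈ I := by
      have h1 := sub_mem hx h0
      rw [sub_sub_cancel, RingHom.mem_ker, AlgHom.commutes] at h1
      exact Ideal.Quotient.eq_zero_iff_mem.mp h1
    have := add_mem hb (Ideal.mem_sup_right (Ideal.mem_map_of_mem (algebraMap A D) hbI))
    rwa [sub_add_cancel] at this
  let π : D →ₗ[D] D ⧸ ID := Submodule.mkQ ID
  have hmapID : Submodule.map π ID = ⊥ := Submodule.mkQ_map_self ID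
  have hmapJ : Submodule.map π J = Submodule.map π F := by
    refine le_antisymm ((Submodule.map_mono hJF).trans ?_) (Submodule.map_mono hF)
    rw [Submodule.map_sup, hmapID, sup_bot_eq]
  obtain ⟨e, he, h⟩ := Submodule.exists_sub_one_mem_and_smul_eq_zero_of_fg_of_le_smul J
    (Submodule.map π J) (by
      rw [hmapJ]
      exact Submodule.FG.map _ (Submodule.fg_span (s.finite_toSet.image _))) (by
      refine (Submodule.map_mono hJQ).trans ?_
      rw [Submodule.map_sup, hmapID, sup_bot_eq, pow_two, ← smul_eq_mul, Submodule.map_smul''])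
  refine ⟨e, ?_, fun x hx ↦ ?_⟩
  · rwa [RingHom.mem_ker, map_sub, map_one, sub_eq_zero] at he
  · have := h (π x) (Submodule.mem_map_of_mem hx)
    rw [← map_smul] at this
    exact (Submodule.Quotient.mk_eq_zero _).mp this

/-- Multiplication by elements of a subalgebra `C` preserves `I • C`. -/
theorem Subalgebra.mul_mem_smul_toSubmodule
    {A D : Type*} [CommRing A] [CommRing D] [Algebra A D] (I : Ideal A) (C : Subalgebra A D)
    {c y : D} (hc : c ∈ C) (hy : y ∈ I • C.toSubmodule) : c * y ∈ I • C.toSubmodule := by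
  induction hy using Submodule.smul_induction_on' with
  | smul a ha x hx =>
    rw [mul_smul_comm]
    exact Submodule.smul_mem_smul ha (C.mul_mem hc hx)
  | add x _ y _ hx hy =>
    rw [mul_add]
    exact add_mem hx hy

/-- A function which is `1` on the section `σ` and cuts out the section modulo `I` may be chosen
in a subalgebra `C` over which `D` becomes equal after inverting some `r`. -/
theorem Subalgebra.exists_mem_forall_mul_mem_smul_toSubmodule
    {A D : Type*} [CommRing A] [CommRing D] [Algebra A D] {I : Ideal A} (σ : D →ₐ[A] A ⧸ I)
    (C : Subalgebra A D) (r : D) (hrC : r ∈ C) (hσr : σ r = 1) (hr : ∀ x, ∃ m : ℕ, r ^ m * x ∈ C)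
    (e : D) (hσe : σ e = 1) (he : ∀ x, σ x = 0 → e * x ∈ I.map (algebraMap A D)) :
    ∃ t ∈ C, σ t = 1 ∧ ∀ x ∈ C, σ x = 0 → t * x ∈ I • C.toSubmodule := by
  have hmap (y : D) (hy : y ∈ I.map (algebraMap A D)) :
      ∃ m : ℕ, r ^ m * y ∈ I • C.toSubmodule := by
    induction hy using Submodule.span_induction with
    | mem y hy =>
      obtain ⟨a, ha, rfl⟩ := hy
      refine ⟨0, ?_⟩
      rw [pow_zero, one_mul, Algebra.algebraMap_eq_smul_one]
      exact Submodule.smul_mem_smul ha C.one_mem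
    | zero => exact ⟨0, by simp⟩
    | add x y _ _ hx hy =>
      obtain ⟨i, hi⟩ := hx
      obtain ⟨j, hj⟩ := hy
      refine ⟨i + j, ?_⟩
      convert add_mem (C.mul_mem_smul_toSubmodule I (C.pow_mem hrC j) hi)
        (C.mul_mem_smul_toSubmodule I (C.pow_mem hrC i) hj) using 1
      ring
    | smul d y _ hy =>
      obtain ⟨i, hi⟩ := hy
      obtain ⟨j, hj⟩ := hr d
      refine ⟨j + i, ?_⟩
      convert C.mul_mem_smul_toSubmodule I hj hi using 1
      rw [smul_eq_mul]
      ring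
  obtain ⟨M, hM⟩ := hr e
  have key (x : D) (hx : σ x = 0) : ∃ m : ℕ, r ^ m * (r ^ M * e * x) ∈ I • C.toSubmodule := by
    refine hmap _ ?_
    rw [mul_assoc]
    exact Ideal.mul_mem_left _ _ (he x hx)
  obtain ⟨K, hK⟩ := key (r - 1) (by rw [map_sub, hσr, map_one, sub_self])
  have hpow (j : ℕ) : r ^ K * (r ^ M * e) * (r ^ j - 1) ∈ I • C.toSubmodule := by
    obtain ⟨q, hq⟩ : ∃ q ∈ C, r ^ j - 1 = q * (r - 1) :=
      ⟨_, C.sum_mem fun i _ ↦ C.pow_mem hrC i, (geom_sum_mul r j).symm⟩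
    convert C.mul_mem_smul_toSubmodule I hq.1 hK using 1
    rw [hq.2]
    ring
  refine ⟨r ^ K * (r ^ M * e), C.mul_mem (C.pow_mem hrC K) hM, by simp [hσr, hσe],
    fun x hxC hx ↦ ?_⟩
  obtain ⟨m, hm⟩ := key x hx
  convert sub_mem (C.mul_mem_smul_toSubmodule I (C.pow_mem hrC K) hm)
    (C.mul_mem_smul_toSubmodule I hxC (hpow m)) using 1
  ring

/-- A function `t` on a finite algebra `C` which is `1` on the section `σ` and cuts out the section
modulo `I` is a root of a monic polynomial of which `1` is a simple root modulo `I`. -/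
theorem Subalgebra.exists_monic_aeval_eq_zero_of_forall_mul_mem_smul
    {A D : Type*} [CommRing A] [CommRing D] [Algebra A D] {I : Ideal A} (σ : D →ₐ[A] A ⧸ I)
    (C : Subalgebra A D) (hC : C.toSubmodule.FG) (t : D) (htC : t ∈ C) (hσt : σ t = 1)
    (ht : ∀ x ∈ C, σ x = 0 → t * x ∈ I • C.toSubmodule) :
    ∃ f : Polynomial A, f.Monic ∧ f.aeval t = 0 ∧ f.eval 1 ∈ I ∧
      Ideal.Quotient.mk I (f.derivative.eval 1) = 1 := by
  obtain ⟨n, y, hy⟩ := Submodule.fg_iff_exists_fin_generating_family.mp hC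
  have hlift (i : Fin n) : ∃ a : A, σ (y i) = Ideal.Quotient.mk I a := by
    obtain ⟨a, ha⟩ := Ideal.Quotient.mk_surjective (σ (y i))
    exact ⟨a, ha.symm⟩
  choose a ha using hlift
  let x : Option (Fin n) → D := fun j ↦ j.elim t fun i ↦ y i - a i • t
  have hyC (i : Fin n) : y i ∈ C := by
    have : y i ∈ Submodule.span A (Set.range y) := Submodule.subset_span ⟨i, rfl⟩
    rwa [hy] at this
  have hxC (j : Option (Fin n)) : x j ∈ C := by
    cases j with
    | none => exact htC
    | some i => exact C.sub_mem (hyC i) (C.smul_mem htC _)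
  have hspan : Submodule.span A (Set.range x) = C.toSubmodule := by
    refine le_antisymm (Submodule.span_le.mpr ?_) ?_
    · rintro _ ⟨j, rfl⟩
      exact hxC j
    · rw [← hy, Submodule.span_le]
      rintro _ ⟨i, rfl⟩
      have h1 : x (some i) ∈ Submodule.span A (Set.range x) := Submodule.subset_span ⟨_, rfl⟩
      have h2 : x none ∈ Submodule.span A (Set.range x) := Submodule.subset_span ⟨_, rfl⟩
      have := add_mem h1 (Submodule.smul_mem _ (a i) h2)
      simpa [x] using this
  let δ : Option (Fin n) → A := Pi.single none 1
  have hmem (j : Option (Fin n)) : t * x j - δ j • x j ∈ I • C.toSubmodule := by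
    cases j with
    | none =>
      have h := ht (t - 1) (C.sub_mem htC C.one_mem) (by rw [map_sub, map_one, hσt, sub_self])
      rw [mul_sub, mul_one] at h
      simpa [x, δ] using h
    | some i =>
      have h := ht (x (some i)) (hxC _) (by
        simp [x, map_sub, ha, hσt, Algebra.smul_def])
      simpa [δ] using h
  have hcomb (j : Option (Fin n)) : ∃ c : Option (Fin n) → A, (∀ k, c k ∈ I) ∧
      ∑ k, c k • x k = t * x j - δ j • x j := by
    have h := hmem j
    rw [← hspan] at h
    obtain ⟨c, hcI, hc⟩ := (Submodule.mem_ideal_smul_span_iff_exists_sum I x _).mp h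
    exact ⟨c, hcI, by rw [← hc, Finsupp.sum_fintype _ _ (by simp)]⟩
  choose c hcI hc using hcomb
  let P : Matrix (Option (Fin n)) (Option (Fin n)) A := Matrix.diagonal δ + Matrix.of c
  refine ⟨P.charpoly, P.charpoly_monic, ?_, ?_⟩
  · let T := Matrix.scalar _ t - P.map (algebraMap A D)
    have hT : T.mulVec x = 0 := by
      have hP : (P.map (algebraMap A D)).mulVec x = t • x := by
        ext j
        have h (k : Option (Fin n)) : algebraMap A D (P j k) * x k =
            algebraMap A D (Matrix.diagonal δ j k) * x k + c j k • x k := by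
          rw [Algebra.smul_def, ← add_mul, ← map_add]
          rfl
        change ∑ k, algebraMap A D (P j k) * x k = t * x j
        simp only [h, Finset.sum_add_distrib, hc]
        simp [Matrix.diagonal_apply, apply_ite, ite_mul, Algebra.smul_def]
      rw [Matrix.sub_mulVec, hP, sub_eq_zero, Matrix.scalar_apply, ← Matrix.smul_one_eq_diagonal,
        Matrix.smul_mulVec, Matrix.one_mulVec]
    have hdet : T.det = P.charpoly.aeval t := by
      rw [Polynomial.aeval_def, ← Polynomial.eval_map, ← Matrix.charpoly_map, Matrix.eval_charpoly]
    have hx (j : Option (Fin n)) : T.det * x j = 0 := by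
      have h := congr_arg (T.adjugate.mulVec) hT
      rw [Matrix.mulVec_mulVec, Matrix.adjugate_mul, Matrix.smul_mulVec, Matrix.one_mulVec,
        Matrix.mulVec_zero] at h
      exact congr_fun h j
    have h1 : (1 : D) ∈ Submodule.span A (Set.range x) := hspan ▸ C.one_mem
    have hle : Submodule.span A (Set.range x) ≤ (LinearMap.mulLeft A T.det).ker :=
      Submodule.span_le.mpr (by rintro _ ⟨j, rfl⟩; exact hx j)
    rw [← hdet]
    simpa using hle h1
  · have hP : P.map (Ideal.Quotient.mk I) = Matrix.diagonal (Pi.single none 1) := by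
      ext j k
      have : Ideal.Quotient.mk I (c j k) = 0 := Ideal.Quotient.eq_zero_iff_mem.mpr (hcI j k)
      rw [Matrix.map_apply, show P j k = Matrix.diagonal δ j k + c j k from rfl, map_add, this,
        add_zero]
      obtain rfl | h := eq_or_ne j k
      · cases j <;> simp [δ]
      · simp [h]
    have hf : P.charpoly.map (Ideal.Quotient.mk I) =
        (Polynomial.X - 1) * Polynomial.X ^ n := by
      rw [← Matrix.charpoly_map, hP, Matrix.charpoly_diagonal, Fintype.prod_option]
      simp
    constructor
    · rw [← Ideal.Quotient.eq_zero_iff_mem, ← Polynomial.eval_map_apply, hf]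
      simp
    · rw [← Polynomial.eval_map_apply, ← Polynomial.derivative_map, hf]
      simp

/-- Over a Henselian pair, a function `t` on a finite algebra `C` which is `1` on the section `σ`
and cuts out the section modulo `I` gives rise to an idempotent whose component is a quotient
of `A`. -/
theorem Subalgebra.exists_isIdempotentElem_of_forall_mul_mem_smul
    {A D : Type*} [CommRing A] [CommRing D] [Algebra A D] {I : Ideal A} [HenselianRing A I]
    (σ : D →ₐ[A] A ⧸ I) (C : Subalgebra A D) (hC : C.toSubmodule.FG) (t : D) (htC : t ∈ C)
    (hσt : σ t = 1) (ht : ∀ x ∈ C, σ x = 0 → t * x ∈ I • C.toSubmodule) :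
    ∃ ε : D, IsIdempotentElem ε ∧ σ ε = 1 ∧ ∀ x ∈ C, ∃ a : A, ε * x = a • ε := by
  have hjac : I ≤ Ideal.jacobson ⊥ := HenselianRing.jac
  have hloc := isLocalHom_of_le_jacobson_bot I hjac
  obtain ⟨f, hf, hft, hf1, hf1'⟩ :=
    C.exists_monic_aeval_eq_zero_of_forall_mul_mem_smul σ hC t htC hσt ht
  obtain ⟨a, hfa, ha⟩ := HenselianRing.is_henselian f hf 1 hf1 (by rw [hf1']; exact isUnit_one)
  have ha1 : Ideal.Quotient.mk I a = 1 := by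
    rw [← map_one (Ideal.Quotient.mk I)]
    exact Ideal.Quotient.eq.mpr ha
  obtain ⟨q, rfl⟩ := Polynomial.dvd_iff_isRoot.mpr hfa
  have hq1 : Ideal.Quotient.mk I (q.eval 1) = 1 := by
    simpa [Polynomial.derivative_mul, ha1] using hf1'
  have hqa : IsUnit (q.eval a) := by
    refine isUnit_of_map_unit (Ideal.Quotient.mk I) _ ?_
    rw [← Polynomial.eval_map_apply, ha1, ← map_one (Ideal.Quotient.mk I),
      Polynomial.eval_map_apply, hq1]
    exact isUnit_one
  have hua : IsUnit a := isUnit_of_map_unit (Ideal.Quotient.mk I) _ (by rw [ha1]; exact isUnit_one)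
  obtain ⟨u, hu⟩ := hqa.exists_left_inv
  have htq : t * q.aeval t = a • q.aeval t := by
    rw [Algebra.smul_def, ← sub_eq_zero, ← sub_mul]
    simpa using hft
  have haev (p : Polynomial A) : p.aeval t * q.aeval t = p.eval a • q.aeval t := by
    induction p using Polynomial.induction_on' with
    | add p₁ p₂ h₁ h₂ => rw [map_add, add_mul, h₁, h₂, Polynomial.eval_add, add_smul]
    | monomial n b =>
      rw [Polynomial.aeval_monomial, Polynomial.eval_monomial, mul_assoc, ← Algebra.smul_def,
        mul_smul]
      congr 1
      induction n with
      | zero => simp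
      | succ n ih => rw [pow_succ, mul_assoc, htq, mul_smul_comm, ih, smul_smul, pow_succ']
  let ε := u • q.aeval t
  have hεt : ε * t = a • ε := by
    rw [smul_mul_assoc, mul_comm, htq, smul_comm]
  have hε : IsIdempotentElem ε := by
    change u • _ * u • _ = _
    rw [smul_mul_smul_comm, haev, smul_smul, mul_assoc, hu, mul_one]
  have hσε : σ ε = 1 := by
    have hu1 : Ideal.Quotient.mk I u = 1 := by
      have := congr_arg (Ideal.Quotient.mk I) hu
      rwa [map_mul, ← Polynomial.eval_map_apply, ha1, ← map_one (Ideal.Quotient.mk I),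
        Polynomial.eval_map_apply, hq1, map_one, mul_one] at this
    rw [map_smul, ← Polynomial.aeval_algHom_apply, hσt, Algebra.smul_def,
      ← map_one (algebraMap A (A ⧸ I)), Polynomial.aeval_algebraMap_apply, Polynomial.coe_aeval_eq_eval,
      Ideal.Quotient.algebraMap_eq, hu1, hq1, one_mul, map_one]
  let N' := C.toSubmodule.map (LinearMap.mulLeft A ε)
  have hN' : N' ≤ A ∙ ε := by
    refine Submodule.le_of_le_smul_of_le_jacobson_bot (hC.map _) hjac ?_
    rintro _ ⟨x, hx, rfl⟩
    obtain ⟨b, hb⟩ := Ideal.Quotient.mk_surjective (σ x)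
    have hxb : σ (x - algebraMap A D b) = 0 := by
      rw [map_sub, AlgHom.commutes, ← hb, sub_eq_zero]
      rfl
    have h := Submodule.mem_map_of_mem (f := LinearMap.mulLeft A ε)
      (ht _ (C.sub_mem hx (C.algebraMap_mem b)) hxb)
    rw [Submodule.map_smul'', LinearMap.mulLeft_apply, ← mul_assoc, hεt, smul_mul_assoc] at h
    obtain ⟨v, hv⟩ := hua.exists_left_inv
    replace h := Submodule.smul_mem _ v h
    rw [smul_smul, hv, one_smul] at h
    refine Submodule.mem_sup.mpr ⟨b • ε, Submodule.smul_mem _ _ (Submodule.mem_span_singleton_self _),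
      _, h, ?_⟩
    rw [LinearMap.mulLeft_apply, Algebra.smul_def]
    ring
  refine ⟨ε, hε, hσε, fun x hx ↦ ?_⟩
  obtain ⟨b, hb⟩ := Submodule.mem_span_singleton.mp (hN' (Submodule.mem_map_of_mem hx))
  exact ⟨b, hb.symm⟩

/-- Over a Henselian pair, a section modulo `I` of a finite type algebra `D` whose differentials
vanish near the section lies on a component of `D` which is a quotient of `A`. -/
theorem Algebra.exists_isIdempotentElem_of_smul_kaehlerDifferential_eq_zero
    {A D : Type*} [CommRing A] [CommRing D] [Algebra A D] [Algebra.FiniteType A D]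
    {I : Ideal A} [HenselianRing A I] (σ : D →ₐ[A] A ⧸ I) (g : D) (hσg : σ g = 1)
    (hg : ∀ ω : Ω[D⁄A], g • ω = 0) :
    ∃ ε : D, IsIdempotentElem ε ∧ σ ε = 1 ∧ ∀ x, ∃ a : A, ε * x = a • ε := by
  obtain ⟨r, hσr, hr⟩ :=
    exists_forall_isIntegral_pow_mul_of_smul_kaehlerDifferential_eq_zero σ g hσg hg
  obtain ⟨C, hC, hrC, hrmem⟩ := exists_subalgebra_fg_forall_pow_mul_mem r hr
  obtain ⟨e, hσe, he⟩ :=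
    exists_mul_ker_le_map_of_smul_kaehlerDifferential_eq_zero σ g hσg hg
  obtain ⟨t, htC, hσt, ht⟩ :=
    C.exists_mem_forall_mul_mem_smul_toSubmodule σ r hrC hσr hrmem e hσe he
  obtain ⟨ε, hε, hσε, hεC⟩ :=
    C.exists_isIdempotentElem_of_forall_mul_mem_smul σ hC t htC hσt ht
  refine ⟨ε, hε, hσε, fun x ↦ ?_⟩
  obtain ⟨a, ha⟩ := hεC r hrC
  have hloc := isLocalHom_of_le_jacobson_bot I HenselianRing.jac
  have hua : IsUnit a := by
    refine isUnit_of_map_unit (Ideal.Quotient.mk I) _ ?_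
    have := congr_arg σ ha
    rw [map_mul, map_smul, hσε, hσr, Algebra.smul_def, mul_one, mul_one] at this
    exact this ▸ isUnit_one
  obtain ⟨v, hv⟩ := hua.exists_left_inv
  have hpow (m : ℕ) : ε * r ^ m = a ^ m • ε := by
    induction m with
    | zero => simp
    | succ m ih => rw [pow_succ, ← mul_assoc, ih, smul_mul_assoc, ha, smul_smul, pow_succ]
  obtain ⟨m, hm⟩ := hrmem x
  obtain ⟨b, hb⟩ := hεC _ hm
  refine ⟨v ^ m * b, ?_⟩
  rw [mul_smul, ← hb, ← mul_assoc, hpow, smul_mul_assoc, smul_smul, ← mul_pow, hv, one_pow,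
    one_smul]

/-- Sections modulo `I` of a smooth algebra over a Henselian pair lift. -/
theorem Algebra.Smooth.exists_algHom_quotient_comp_eq_of_henselianRing
    {A B : Type*} [CommRing A] [CommRing B] [Algebra A B] [Algebra.Smooth A B]
    (I : Ideal A) [HenselianRing A I] (σ : B →ₐ[A] A ⧸ I) :
    ∃ φ : B →ₐ[A] A, (Ideal.Quotient.mkₐ A I).comp φ = σ := by
  let J := RingHom.ker σ
  have hlift (b : B) : ∃ a : A, b - algebraMap A B a ∈ J := by
    obtain ⟨a, ha⟩ := Ideal.Quotient.mk_surjective (σ b)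
    refine ⟨a, ?_⟩
    rw [RingHom.mem_ker, map_sub, AlgHom.commutes, ← ha, sub_eq_zero]
    rfl
  obtain ⟨l, hl⟩ := KaehlerDifferential.exists_linearMap_sub_mem_smul_top J hlift
  obtain ⟨g, hgJ, hg⟩ :=
    KaehlerDifferential.exists_sub_one_mem_and_smul_quotient_eq_zero J l fun ω ↦ (hl ω).2
  have hlJ : l.range ≤ J := by
    rintro _ ⟨ω, rfl⟩
    exact (hl ω).1
  let K : Ideal B := l.range
  let σ' : B ⧸ K →ₐ[A] A ⧸ I := Ideal.Quotient.liftₐ K σ fun b hb ↦ hlJ hb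
  have hσ' (b : B) : σ' (Ideal.Quotient.mk K b) = σ b := rfl
  have : Algebra.FiniteType A (B ⧸ K) :=
    .of_surjective (Ideal.Quotient.mkₐ A K) (Ideal.Quotient.mkₐ_surjective A K)
  obtain ⟨ε, hε, hσε, hεD⟩ :=
    exists_isIdempotentElem_of_smul_kaehlerDifferential_eq_zero σ' (Ideal.Quotient.mk K g)
      (by rwa [RingHom.mem_ker, map_sub, map_one, sub_eq_zero] at hgJ) hg
  let L : Ideal B := RingHom.ker
    ((Ideal.Quotient.mk (Ideal.span {1 - ε})).comp (Ideal.Quotient.mk K))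
  have hL (b : B) : b ∈ L ↔ ε * Ideal.Quotient.mk K b = 0 := by
    rw [RingHom.mem_ker, RingHom.comp_apply, Ideal.Quotient.eq_zero_iff_mem,
      Ideal.mem_span_singleton']
    constructor
    · rintro ⟨c, hc⟩
      rw [← hc]
      linear_combination -c * hε.eq
    · intro h
      exact ⟨Ideal.Quotient.mk K b, by linear_combination -h⟩
  have hKL : K ≤ L := fun b hb ↦ by
    rw [hL, Ideal.Quotient.eq_zero_iff_mem.mpr hb, mul_zero]
  have hLJ : L ≤ J := fun b hb ↦ by
    have := congr_arg σ' ((hL b).mp hb)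
    rwa [map_mul, hσε, one_mul, map_zero] at this
  obtain ⟨w, hw⟩ := Ideal.Quotient.mk_surjective (1 - ε)
  have hwL : w ∈ L := by
    rw [hL, hw, mul_sub, hε.eq, mul_one, sub_self]
  have hsub (b : B) (hb : b ∈ L) : b - b * w ∈ K := by
    rw [← Ideal.Quotient.eq_zero_iff_mem, map_sub, map_mul, hw]
    linear_combination (hL b).mp hb
  have hLsq : L ≤ K ⊔ L ^ 2 := fun b hb ↦ by
    rw [← sub_add_cancel b (b * w)]
    refine add_mem (Ideal.mem_sup_left (hsub b hb)) (Ideal.mem_sup_right ?_)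
    rw [pow_two]
    exact Ideal.mul_mem_mul hb hwL
  have hLfg : L.FG := by
    have : L = K ⊔ Ideal.span {w} := by
      refine le_antisymm (fun b hb ↦ ?_) (sup_le hKL (by simpa using hwL))
      rw [← sub_add_cancel b (b * w)]
      exact add_mem (Ideal.mem_sup_left (hsub b hb))
        (Ideal.mem_sup_right (Ideal.mul_mem_left _ _ (Ideal.mem_span_singleton_self w)))
    rw [this]
    refine Submodule.FG.sup ?_ ⟨{w}, by simp⟩
    change l.range.FG
    rw [LinearMap.range_eq_map]
    exact Module.Finite.fg_top.map l
  have hB (b : B) : ∃ a : A, b - algebraMap A B a ∈ L := by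
    obtain ⟨a, ha⟩ := hεD (Ideal.Quotient.mk K b)
    refine ⟨a, ?_⟩
    rw [hL, map_sub, mul_sub, ha, Algebra.smul_def, mul_comm, sub_eq_zero]
    rfl
  have hsq := L.comap_algebraMap_le_sq_of_le_range_sup_sq l hKL hLsq hB
  have hbot : L.comap (algebraMap A B) = ⊥ := by
    have : Algebra.FinitePresentation A (B ⧸ L) := .quotient hLfg
    have hsurj : Function.Surjective (Algebra.ofId A (B ⧸ L)) := fun x ↦ by
      obtain ⟨b, rfl⟩ := Ideal.Quotient.mk_surjective x
      obtain ⟨a, ha⟩ := hB b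
      exact ⟨a, (Ideal.Quotient.eq.mpr ha).symm⟩
    have hfg := Algebra.FinitePresentation.ker_fG_of_surjective _ hsurj
    have hker : RingHom.ker (Algebra.ofId A (B ⧸ L)).toRingHom = L.comap (algebraMap A B) := by
      ext a
      exact Ideal.Quotient.eq_zero_iff_mem
    rw [hker] at hfg
    refine Submodule.eq_bot_of_le_smul_of_le_jacobson_bot I _ hfg ?_ HenselianRing.jac
    refine hsq.trans ?_
    rw [pow_two]
    refine Ideal.mul_mono_left fun a ha ↦ ?_
    have := hLJ ha
    rw [RingHom.mem_ker, AlgHom.commutes] at this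
    exact Ideal.Quotient.eq_zero_iff_mem.mp this
  obtain ⟨ψ, hψ⟩ := L.exists_algHom_quotient_comap hB
  let e := (Ideal.quotientEquivAlgOfEq A hbot).trans (AlgEquiv.quotientBot A A)
  refine ⟨e.toAlgHom.comp ψ, AlgHom.ext fun b ↦ ?_⟩
  obtain ⟨a, ha⟩ := hB b
  have h1 : σ (b - algebraMap A B a) = 0 := hLJ ha
  have h2 := hψ _ ha
  rw [map_sub, sub_eq_zero, AlgHom.commutes] at h1 h2
  rw [AlgHom.comp_apply, AlgHom.comp_apply, h1, h2, AlgHom.commutes, AlgHom.commutes]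

/-- for a smooth affine `R`-scheme `X = Spec S` and a Henselian pair
`(A, I)`, the map `X(A) → X(A/I)` is surjective. -/
theorem smooth_affine_points_surjective_of_henselian
    (R : Type u) (S : Type u) (A : Type u) [CommRing R] [CommRing S] [CommRing A]
    [Algebra R S] [Algebra.Smooth R S] [Algebra R A]
    (I : Ideal A) [HenselianRing A I] :
    Function.Surjective
      (fun φ : S →ₐ[R] A => (Ideal.Quotient.mkₐ R I).comp φ) := by
  intro ψ
  let σ : TensorProduct R A S →ₐ[A] A ⧸ I :=
    Algebra.TensorProduct.lift (Algebra.ofId A (A ⧸ I)) ψ fun _ _ ↦ Commute.all _ _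
  obtain ⟨φ, hφ⟩ := Algebra.Smooth.exists_algHom_quotient_comp_eq_of_henselianRing I σ
  refine ⟨(φ.restrictScalars R).comp Algebra.TensorProduct.includeRight, AlgHom.ext fun s ↦ ?_⟩
  have h := DFunLike.congr_fun hφ (1 ⊗ₜ[R] s)
  refine h.trans ?_
  simp [σ]
end

section
/- Let R be a ring, A an R-algebra, and I ⊆ J ideals of A such that (A, I) is a Henselian pair. Let H be an affine smooth group scheme over R and P ⊆ H a closed subgroup scheme. Then the projection H(A) → H(A/I) induces a bijection of quotient sets (H(A) ×_{H(A/J)} P(A/J)) / (H(A) ×_{H(A/I)} P(A/I)) ≅ (H(A/I) ×_{H(A/J)} P(A/J)) / P(A/I). -/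
universe u

open Polynomial in
/-- If `b` acts on a finite generating family through a matrix, it is a root of the
characteristic polynomial of that matrix. -/
lemma Matrix.aeval_charpoly_eq_zero_of_mulVec_eq_smul {A B n : Type*} [CommRing A] [CommRing B]
    [Algebra A B] [Fintype n] [DecidableEq n] (M : Matrix n n A) (w : n → B) (b : B)
    (hw : Submodule.span A (Set.range w) = ⊤)
    (hM : ∀ i, b * w i = ∑ j, M i j • w j) : aeval b M.charpoly = 0 := by
  set N : Matrix n n B := Matrix.scalar n b - M.map (algebraMap A B) with hN
  have hdet : aeval b M.charpoly = N.det := by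
    rw [← eval_map_algebraMap, ← Matrix.charpoly_map, Matrix.eval_charpoly]
  have hNw : N.mulVec w = 0 := by
    ext i
    simp [hN, Matrix.mulVec, dotProduct, Matrix.diagonal_apply, sub_mul, hM, Algebra.smul_def]
  have hsmul : N.det • w = 0 := by
    rw [← Matrix.one_mulVec (N.det • w), Matrix.mulVec_smul, ← Matrix.smul_mulVec,
      ← Matrix.adjugate_mul, ← Matrix.mulVec_mulVec, hNw, Matrix.mulVec_zero]
  have hone : (1 : B) ∈ Submodule.span A (Set.range w) := hw ▸ Submodule.mem_top
  obtain ⟨c, hc⟩ := (Submodule.mem_span_range_iff_exists_fun A).1 hone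
  rw [hdet, ← mul_one N.det, ← hc, Finset.mul_sum]
  refine Finset.sum_eq_zero fun i _ ↦ ?_
  have hi : N.det * w i = 0 := congrFun hsmul i
  rw [mul_smul_comm, hi, smul_zero]

namespace MvPolynomial

/-- The chain rule for a derivation applied to the value of a polynomial. -/
lemma derivation_aeval {R B σ : Type*} [CommRing R] [CommRing B] [Algebra R B] [Fintype σ]
    (d : Derivation R B B) (x : σ → B) (p : MvPolynomial σ R) :
    d (aeval x p) = ∑ i, aeval x (pderiv i p) * d (x i) := by
  classical
  induction p using MvPolynomial.induction_on with
  | C r => simp [algHom_C]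
  | add p q hp hq => simp [hp, hq, add_mul, Finset.sum_add_distrib]
  | mul_X p j hp =>
    simp [hp, pderiv_X, Pi.single_apply, add_mul, Finset.sum_add_distrib, Finset.mul_sum,
      apply_ite (aeval x), mul_assoc]

/-- The first order Taylor expansion of a polynomial along a perturbation in an ideal. -/
lemma aeval_X_add_sub_mem_sq {R σ : Type*} [CommRing R] [Fintype σ] {K : Ideal (MvPolynomial σ R)}
    (δ : σ → MvPolynomial σ R) (hδ : ∀ i, δ i ∈ K) (p : MvPolynomial σ R) :
    aeval (fun i ↦ X i + δ i) p - (p + ∑ i, pderiv i p * δ i) ∈ K ^ 2 := by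
  classical
  induction p using MvPolynomial.induction_on with
  | C r => simp [algHom_C]
  | add p q hp hq =>
    convert add_mem hp hq using 1
    simp only [map_add, add_mul, Finset.sum_add_distrib]
    ring
  | mul_X p j hp =>
    have hj : (∑ i, pderiv i p * δ i) * δ j ∈ K ^ 2 := by
      rw [pow_two]
      exact Ideal.mul_mem_mul (sum_mem fun i _ ↦ Ideal.mul_mem_left _ _ (hδ i)) (hδ j)
    convert add_mem (Ideal.mul_mem_right (X j + δ j) _ hp) hj using 1
    have hs : ∑ i, pderiv i (p * X j) * δ i = p * δ j + X j * ∑ i, pderiv i p * δ i := by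
      simp [pderiv_X, Pi.single_apply, add_mul, Finset.sum_add_distrib, Finset.mul_sum,
        mul_assoc]
    rw [hs, map_mul, aeval_X]
    ring

lemma pderiv_mem_of_mem_sq {R σ : Type*} [CommRing R] {K : Ideal (MvPolynomial σ R)}
    {p : MvPolynomial σ R} (hp : p ∈ K ^ 2) (i : σ) : pderiv i p ∈ K := by
  rw [pow_two] at hp
  induction hp using Submodule.mul_induction_on' with
  | mem_mul_mem x hx y hy =>
    rw [Derivation.leibniz]
    exact add_mem (Ideal.mul_mem_right _ _ hx) (Ideal.mul_mem_right _ _ hy)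
  | add x _ y _ hx hy => rw [map_add]; exact add_mem hx hy

/-- Formal smoothness of a polynomial quotient gives a first order perturbation of the variables
along which the equations vanish to second order. -/
lemma exists_aeval_X_add_mem_sq {R S σ : Type*} [CommRing R] [CommRing S] [Algebra R S]
    [Algebra.FormallySmooth R S] (π : MvPolynomial σ R →ₐ[R] S) (hπ : Function.Surjective π) :
    ∃ δ : σ → MvPolynomial σ R, (∀ i, δ i ∈ RingHom.ker π) ∧
      ∀ p ∈ RingHom.ker π, aeval (fun i ↦ X i + δ i) p ∈ RingHom.ker π ^ 2 := by
  let K := RingHom.ker π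
  let g : (MvPolynomial σ R ⧸ K ^ 2) →ₐ[R] S :=
    Ideal.Quotient.liftₐ _ π fun p hp ↦ Ideal.pow_le_self two_ne_zero hp
  have hgmk : ∀ p, g (Ideal.Quotient.mk _ p) = π p := fun p ↦ rfl
  have hg : Function.Surjective g := fun s ↦ by
    obtain ⟨p, rfl⟩ := hπ s
    exact ⟨_, hgmk p⟩
  have hker : RingHom.ker (g : (MvPolynomial σ R ⧸ K ^ 2) →+* S) ^ 2 = ⊥ := by
    rw [eq_bot_iff, pow_two (RingHom.ker (g : (MvPolynomial σ R ⧸ K ^ 2) →+* S)), Ideal.mul_le]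
    intro x hx y hy
    obtain ⟨p, rfl⟩ := Ideal.Quotient.mk_surjective x
    obtain ⟨q, rfl⟩ := Ideal.Quotient.mk_surjective y
    rw [Ideal.mem_bot, ← map_mul, Ideal.Quotient.eq_zero_iff_mem, pow_two K]
    exact Ideal.mul_mem_mul hx hy
  let s := Algebra.FormallySmooth.liftOfSurjective (AlgHom.id R S) g hg ⟨2, hker⟩
  have hs : ∀ x, g (s x) = x := fun x ↦
    Algebra.FormallySmooth.liftOfSurjective_apply (AlgHom.id R S) g hg ⟨2, hker⟩ x
  choose x hx using fun i ↦ Ideal.Quotient.mk_surjective (s (π (X i)))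
  refine ⟨fun i ↦ x i - X i, fun i ↦ ?_, fun p hp ↦ ?_⟩
  · rw [RingHom.mem_ker, map_sub, ← hgmk, hx, hs, sub_self]
  · have h : (Ideal.Quotient.mkₐ R (K ^ 2)).comp (aeval x) = s.comp π := by
      ext i
      simp [hx]
    rw [← Ideal.Quotient.eq_zero_iff_mem]
    simp only [add_sub_cancel]
    refine (DFunLike.congr_fun h p).trans ?_
    rw [AlgHom.comp_apply, RingHom.mem_ker.1 hp, map_zero]

/-- Equations `f` of a formally smooth algebra admit a matrix `D` such that, with
`q = (∂f) * D`, the column `(1 + q) * f` vanishes to second order and `-q` is idempotent modulo the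
equations. -/
lemma exists_matrix_of_formallySmooth {R S σ ι : Type*} [CommRing R] [CommRing S] [Algebra R S]
    [Algebra.FormallySmooth R S] [Fintype σ] [Fintype ι]
    (π : MvPolynomial σ R →ₐ[R] S) (hπ : Function.Surjective π) (f : ι → MvPolynomial σ R)
    (hf : Ideal.span (Set.range f) = RingHom.ker π) :
    ∃ (D : σ → ι → MvPolynomial σ R) (q : ι → ι → MvPolynomial σ R),
      (∀ j k, q j k = ∑ i, pderiv i (f j) * D i k) ∧
      (∀ j, f j + ∑ k, q j k * f k ∈ RingHom.ker π ^ 2) ∧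
      ∀ j k, q j k + ∑ l, q j l * q l k ∈ RingHom.ker π := by
  obtain ⟨δ, hδ, hδf⟩ := exists_aeval_X_add_mem_sq π hπ
  have hfK : ∀ j, f j ∈ RingHom.ker π := fun j ↦ hf ▸ Ideal.subset_span ⟨j, rfl⟩
  have hδ' : ∀ i, ∃ c : ι → MvPolynomial σ R, ∑ k, c k * f k = δ i := fun i ↦
    (Submodule.mem_span_range_iff_exists_fun _).1 (hf.symm ▸ hδ i :)
  choose D hD using hδ'
  have hq : ∀ j, f j + ∑ k, (∑ i, pderiv i (f j) * D i k) * f k ∈ RingHom.ker π ^ 2 := by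
    intro j
    convert sub_mem (hδf _ (hfK j)) (aeval_X_add_sub_mem_sq δ hδ (f j)) using 1
    simp_rw [← hD, sub_sub_cancel, Finset.sum_mul, Finset.mul_sum, mul_assoc]
    rw [Finset.sum_comm]
  refine ⟨D, _, fun j k ↦ rfl, hq, fun j k ↦ ?_⟩
  have hd : ∀ i, pderiv i (f j) + ∑ l, (∑ i, pderiv i (f j) * D i l) * pderiv i (f l) ∈
      RingHom.ker π := by
    intro i
    have h := pderiv_mem_of_mem_sq (hq j) i
    rw [map_add, map_sum] at h
    simp_rw [Derivation.leibniz, Finset.sum_add_distrib, smul_eq_mul] at h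
    rw [← add_assoc] at h
    exact (add_mem_cancel_right (sum_mem fun l _ ↦ Ideal.mul_mem_right _ _ (hfK l))).1 h
  convert sum_mem (fun i (_ : i ∈ Finset.univ) ↦ Ideal.mul_mem_right (D i k) _ (hd i)) using 1
  simp_rw [add_mul, Finset.sum_add_distrib, Finset.sum_mul _ _ (D _ k)]
  rw [Finset.sum_comm (f := fun i l ↦ _ * D i k)]
  simp_rw [mul_assoc _ _ (D _ k), ← Finset.mul_sum]

end MvPolynomial

/-- A surjective group homomorphism induces a bijection on coset spaces of a subgroup and of its
preimage. -/
lemma Subgroup.exists_equiv_quotient_of_surjective {G H : Type*} [Group G] [Group H] (f : G →* H)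
    (hf : Function.Surjective f) (N : Subgroup G) (M : Subgroup H) (hN : N = M.comap f) :
    ∃ e : G ⧸ N ≃ H ⧸ M, ∀ g : G, e (QuotientGroup.mk g) = QuotientGroup.mk (f g) := by
  have h : ∀ a b : G, a⁻¹ * b ∈ N ↔ (f a)⁻¹ * f b ∈ M := fun a b ↦ by
    rw [hN, Subgroup.mem_comap, map_mul, map_inv]
  let φ : G ⧸ N → H ⧸ M := Quotient.map' f fun a b hab ↦
    QuotientGroup.leftRel_apply.2 ((h a b).1 (QuotientGroup.leftRel_apply.1 hab))
  refine ⟨Equiv.ofBijective φ ⟨fun x y ↦ ?_, fun y ↦ ?_⟩, fun g ↦ rfl⟩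
  · induction x using QuotientGroup.induction_on with | _ x
    induction y using QuotientGroup.induction_on with | _ y
    intro hxy
    exact QuotientGroup.eq.2 ((h x y).2 (QuotientGroup.eq.1 hxy))
  · induction y using QuotientGroup.induction_on with | _ y
    obtain ⟨g, rfl⟩ := hf y
    exact ⟨QuotientGroup.mk g, rfl⟩

namespace HenselianRing

variable {A : Type*} [CommRing A] {I : Ideal A}

lemma isUnit_of_sub_one_mem [HenselianRing A I] {x : A} (hx : x - 1 ∈ I) : IsUnit x := by
  simpa using Ideal.mem_jacobson_bot.1 (HenselianRing.jac hx) 1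

open Polynomial in
/-- An element of a finite algebra cutting out a section modulo `I` is a root of a monic polynomial
which has the simple root `1` modulo `I`. -/
lemma exists_monic_aeval_eq_zero (hI : I ≤ Ideal.jacobson ⊥) {B : Type*} [CommRing B] [Algebra A B]
    [Module.Finite A B] (σ : B →ₐ[A] A ⧸ I) (b : B) (hσb : σ b = 1)
    (hb : ∀ y a, σ y = Ideal.Quotient.mk I a →
      b * (y - algebraMap A B a) ∈ I • (⊤ : Submodule A B)) :
    ∃ F : A[X], F.Monic ∧ aeval b F = 0 ∧ F.eval 1 ∈ I ∧ F.derivative.eval 1 - 1 ∈ I := by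
  obtain ⟨k, y, hy⟩ := Module.Finite.exists_fin (R := A) (M := B)
  let w : Option (Fin k) → B := fun o ↦ o.elim b fun j ↦ (1 - b) * y j
  let d : Option (Fin k) → A := fun o ↦ o.elim 1 fun _ ↦ 0
  have hw : Submodule.span A (Set.range w) = ⊤ := by
    refine top_le_iff.1 (Submodule.le_of_le_smul_of_le_jacobson_bot Module.Finite.fg_top hI ?_)
    intro x _
    have h₁ : (1 - b) * x ∈ Submodule.span A (Set.range w) := by
      have hx : x ∈ Submodule.span A (Set.range y) := hy ▸ Submodule.mem_top
      induction hx using Submodule.span_induction with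
      | mem x hx =>
        obtain ⟨j, rfl⟩ := hx
        exact Submodule.subset_span ⟨some j, rfl⟩
      | zero => simp
      | add x z _ _ hx hz => rw [mul_add]; exact add_mem (hx trivial) (hz trivial)
      | smul c x _ hx => rw [mul_smul_comm]; exact Submodule.smul_mem _ _ (hx trivial)
    obtain ⟨a, ha⟩ := Ideal.Quotient.mk_surjective (σ x)
    have h₂ : a • b ∈ Submodule.span A (Set.range w) :=
      Submodule.smul_mem _ _ (Submodule.subset_span ⟨none, rfl⟩)
    have : x = ((1 - b) * x + a • b) + b * (x - algebraMap A B a) := by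
      rw [Algebra.smul_def]; ring
    rw [this]
    exact Submodule.add_mem_sup (add_mem h₁ h₂) (hb x a ha.symm)
  have hbw : ∀ i, b * w i - d i • w i ∈ I • Submodule.span A (Set.range w) := by
    rw [hw]
    rintro (_ | j)
    · have := hb b 1 (by simpa using hσb)
      simpa [w, d, mul_sub] using this
    · have := hb ((1 - b) * y j) 0 (by simp [hσb])
      simpa [w, d] using this
  have hbw' : ∀ i, ∃ c : Option (Fin k) → A, (∀ j, c j ∈ I) ∧
      b * w i = ∑ j, (Matrix.diagonal d i j + c j) • w j := by
    intro i
    obtain ⟨c, hc, hcs⟩ := (Submodule.mem_ideal_smul_span_iff_exists_sum I w _).1 (hbw i)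
    refine ⟨c, hc, ?_⟩
    rw [Finsupp.sum_fintype _ _ (by simp)] at hcs
    simp [add_smul, Finset.sum_add_distrib, hcs, Matrix.diagonal_apply]
  choose c hc hcw using hbw'
  let M : Matrix (Option (Fin k)) (Option (Fin k)) A := Matrix.of fun i j ↦
    Matrix.diagonal d i j + c i j
  have hM : M.map (Ideal.Quotient.mk I) = Matrix.diagonal fun i ↦ Ideal.Quotient.mk I (d i) := by
    ext i j
    have : Ideal.Quotient.mk I (c i j) = 0 := Ideal.Quotient.eq_zero_iff_mem.2 (hc i j)
    simp [M, this, Matrix.diagonal_apply, apply_ite (Ideal.Quotient.mk I)]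
  have hmap : M.charpoly.map (Ideal.Quotient.mk I) = (X - 1) * X ^ k := by
    rw [← Matrix.charpoly_map, hM, Matrix.charpoly_diagonal, Fintype.prod_option]
    simp [d]
  refine ⟨M.charpoly, M.charpoly_monic,
    Matrix.aeval_charpoly_eq_zero_of_mulVec_eq_smul M w b hw hcw, ?_, ?_⟩
  · rw [← Ideal.Quotient.eq_zero_iff_mem, ← eval_map_apply, hmap]
    simp
  · rw [← Ideal.Quotient.eq_zero_iff_mem, map_sub, ← eval_map_apply, ← derivative_map, hmap]
    simp

open Polynomial in
/-- Over a Henselian pair, a finite algebra with an element cutting out a section modulo `I`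
has an idempotent lifting that element, whose corresponding factor is generated by the idempotent
as a module. -/
lemma exists_isIdempotentElem [HenselianRing A I] {B : Type*} [CommRing B] [Algebra A B]
    [Module.Finite A B] (σ : B →ₐ[A] A ⧸ I) (b : B) (hσb : σ b = 1)
    (hb : ∀ y a, σ y = Ideal.Quotient.mk I a →
      b * (y - algebraMap A B a) ∈ I • (⊤ : Submodule A B)) :
    ∃ e : B, IsIdempotentElem e ∧ σ e = 1 ∧ ∀ y, ∃ a : A, e * y = a • e := by
  obtain ⟨F, hF, hFb, hF₁, hF'⟩ := exists_monic_aeval_eq_zero HenselianRing.jac σ b hσb hb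
  obtain ⟨v, hv, hv₁⟩ := HenselianRing.is_henselian F hF 1 hF₁
    ((isUnit_of_sub_one_mem hF').map _)
  obtain ⟨h, hh⟩ := dvd_iff_isRoot.2 hv
  have hmkv : Ideal.Quotient.mk I v = 1 := by
    rw [← map_one (Ideal.Quotient.mk I)]; exact Ideal.Quotient.eq.2 hv₁
  have hF'v : F.derivative.eval v = h.eval v := by simp [hh]
  have hhv : Ideal.Quotient.mk I (h.eval v) = 1 := by
    rw [← hF'v, ← eval_map_apply, hmkv, ← map_one (Ideal.Quotient.mk I), eval_map_apply]
    exact Ideal.Quotient.eq.2 hF'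
  obtain ⟨r, hr⟩ := isUnit_of_sub_one_mem (x := h.eval v) (I := I)
    (Ideal.Quotient.eq.1 (by simpa using hhv))
  have hbe : b * aeval b h = v • aeval b h := by
    have := hFb
    rw [hh] at this
    simp only [map_mul, map_sub, aeval_X, aeval_C, sub_mul] at this
    rw [Algebra.smul_def]
    exact sub_eq_zero.1 this
  have hpoly : ∀ p : A[X], aeval b p * aeval b h = p.eval v • aeval b h := by
    intro p
    induction p using Polynomial.induction_on' with
    | add p q hp hq => simp [add_mul, add_smul, hp, hq]
    | monomial n a =>
      simp only [aeval_monomial, eval_monomial, mul_assoc, mul_smul]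
      induction n with
      | zero => simp [Algebra.smul_def]
      | succ n ih =>
        rw [pow_succ, mul_assoc, hbe, mul_smul_comm, mul_smul_comm, ih, pow_succ', mul_smul,
          smul_comm v a]
  set e : B := (↑r⁻¹ : A) • aeval b h with he
  have hbe' : b * e = v • e := by rw [he, mul_smul_comm, hbe, smul_comm]
  have hee : IsIdempotentElem e := by
    rw [IsIdempotentElem, he, smul_mul_smul_comm, hpoly, ← hr, smul_smul, mul_assoc,
      Units.inv_mul, mul_one]
  have hσe : σ e = 1 := by
    have h₁ : σ (aeval b h) = 1 := by
      have h₀ : σ b = algebraMap A (A ⧸ I) v := hσb.trans hmkv.symm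
      rw [← aeval_algHom_apply, h₀, aeval_algebraMap_apply]
      exact hhv
    have h₂ : algebraMap A (A ⧸ I) (r : A) = 1 := by rw [hr]; exact hhv
    have h₃ := congr(algebraMap A (A ⧸ I) $(r.inv_mul))
    rw [map_mul, h₂, mul_one, map_one] at h₃
    rw [he, map_smul, h₁, Algebra.smul_def, h₃, mul_one]
  refine ⟨e, hee, hσe, fun y ↦ ?_⟩
  obtain ⟨v', hv'⟩ := isUnit_of_sub_one_mem hv₁
  let N : Submodule A B := LinearMap.range (LinearMap.mulLeft A e)
  have hNfg : N.FG := by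
    rw [show N = _ from LinearMap.range_eq_map _]
    exact Module.Finite.fg_top.map _
  have hN : N ≤ A ∙ e := by
    refine Submodule.le_of_le_smul_of_le_jacobson_bot hNfg (HenselianRing.jac (I := I)) ?_
    rintro _ ⟨x, rfl⟩
    obtain ⟨a, ha⟩ := Ideal.Quotient.mk_surjective (σ x)
    have h₁ : e * (b * (x - algebraMap A B a)) ∈ I • N := by
      have := Submodule.mem_map_of_mem (f := LinearMap.mulLeft A e) (hb x a ha.symm)
      rwa [Submodule.map_smul'', Submodule.map_top] at this
    have h₂ : e * (x - algebraMap A B a) ∈ I • N := by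
      have := Submodule.smul_mem _ (↑v'⁻¹ : A) h₁
      rwa [← mul_assoc, mul_comm e, hbe', ← hv', smul_mul_assoc, smul_smul, Units.inv_mul,
        one_smul] at this
    have : LinearMap.mulLeft A e x = a • e + e * (x - algebraMap A B a) := by
      rw [LinearMap.mulLeft_apply, Algebra.smul_def]; ring
    rw [this]
    exact Submodule.add_mem_sup (Submodule.smul_mem _ _ (Submodule.mem_span_singleton_self e)) h₂
  obtain ⟨a, ha⟩ := Submodule.mem_span_singleton.1 (hN ⟨y, rfl⟩)
  exact ⟨a, ha.symm⟩

/-- **Zariski's main theorem** along a section modulo `I`: there is a single denominator which is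
`1` on the section. -/
lemma exists_isIntegral_pow_mul {S : Type*} [CommRing S] [Algebra A S] [Algebra.FiniteType A S]
    [Algebra.QuasiFinite A S] (σ : S →ₐ[A] A ⧸ I) :
    ∃ g : S, σ g = 1 ∧ IsIntegral A g ∧ ∀ s, ∃ n, IsIntegral A (g ^ n * s) := by
  let F : Set S := {r | IsIntegral A r ∧ ∀ s, ∃ n, IsIntegral A (r ^ n * s)}
  have hF : Ideal.span F = ⊤ := by
    by_contra h
    obtain ⟨q, hq, hle⟩ := Ideal.exists_le_maximal _ h
    have := hq.isPrime
    obtain ⟨r, hrq, hr, hrs⟩ := Algebra.zariskisMainProperty_iff.1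
      (Algebra.ZariskisMainProperty.of_finiteType (R := A) q)
    exact hrq (hle (Ideal.subset_span ⟨hr, hrs⟩))
  have hadd : ∀ r ∈ F, ∀ t ∈ F, r + t ∈ F := by
    rintro r ⟨hr, hrs⟩ t ⟨ht, hts⟩
    refine ⟨hr.add ht, fun s ↦ ?_⟩
    obtain ⟨n, hn⟩ := hrs s
    obtain ⟨m, hm⟩ := hts s
    refine ⟨n + m, ?_⟩
    rw [add_pow, Finset.sum_mul]
    refine IsIntegral.sum _ fun i hi ↦ ?_
    have hi' : i ≤ n + m := Nat.lt_succ_iff.1 (Finset.mem_range.1 hi)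
    have hc : IsIntegral A (((n + m).choose i : ℕ) : S) := by
      simpa using isIntegral_algebraMap (R := A) (A := S) (x := ((n + m).choose i : A))
    obtain h | h := le_total n i
    · have : r ^ i * t ^ (n + m - i) * ((n + m).choose i : S) * s =
          r ^ (i - n) * t ^ (n + m - i) * ((n + m).choose i : S) * (r ^ n * s) := by
        rw [← Nat.sub_add_cancel h, pow_add, Nat.add_sub_cancel]; ring
      rw [this]
      exact (((hr.pow _).mul (ht.pow _)).mul hc).mul hn
    · have hm' : m ≤ n + m - i := by omega
      have : r ^ i * t ^ (n + m - i) * ((n + m).choose i : S) * s =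
          r ^ i * t ^ (n + m - i - m) * ((n + m).choose i : S) * (t ^ m * s) := by
        nth_rewrite 1 [← Nat.sub_add_cancel hm']; rw [pow_add]; ring
      rw [this]
      exact (((hr.pow _).mul (ht.pow _)).mul hc).mul hm
  have key : ∀ x ∈ Ideal.span F, ∃ g ∈ F, σ g = σ x := by
    intro x hx
    induction hx using Submodule.span_induction with
    | mem x hx => exact ⟨x, hx, rfl⟩
    | zero => exact ⟨0, ⟨isIntegral_zero, fun s ↦ ⟨1, by simpa using isIntegral_zero⟩⟩, rfl⟩
    | add x y _ _ hx hy =>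
      obtain ⟨g, hg, hgx⟩ := hx
      obtain ⟨h, hh, hhy⟩ := hy
      exact ⟨g + h, hadd g hg h hh, by rw [map_add, map_add, hgx, hhy]⟩
    | smul c x _ hx =>
      obtain ⟨g, ⟨hg, hgs⟩, hgx⟩ := hx
      obtain ⟨a, ha⟩ := Ideal.Quotient.mk_surjective (σ c)
      refine ⟨a • g, ⟨hg.smul a, fun s ↦ ?_⟩, ?_⟩
      · obtain ⟨n, hn⟩ := hgs s
        refine ⟨n, ?_⟩
        rw [_root_.smul_pow, smul_mul_assoc]
        exact hn.smul _
      · rw [map_smul, hgx, smul_eq_mul, map_mul, ← ha, Algebra.smul_def]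
        rfl
  obtain ⟨g, ⟨hg, hgs⟩, hg₁⟩ := key 1 (hF ▸ Submodule.mem_top)
  exact ⟨g, by rw [hg₁, map_one], hg, hgs⟩

/-- A section modulo `I` of an unramified algebra is cut out, modulo `I`, by an element. -/
lemma exists_mul_sub_mem_map {S : Type*} [CommRing S] [Algebra A S] [Algebra.EssFiniteType A S]
    [Algebra.FormallyUnramified A S] (σ : S →ₐ[A] A ⧸ I) :
    ∃ b : S, σ b = 1 ∧ ∀ s a, σ s = Ideal.Quotient.mk I a →
      b * (s - algebraMap A S a) ∈ I.map (algebraMap A S) := by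
  let K : Ideal S := I.map (algebraMap A S)
  have hK : K ≤ RingHom.ker σ := by
    refine Ideal.map_le_iff_le_comap.2 fun a ha ↦ ?_
    rw [Ideal.mem_comap, RingHom.mem_ker, AlgHom.commutes]
    exact Ideal.Quotient.eq_zero_iff_mem.2 ha
  let ι : A ⧸ I →ₐ[A] S ⧸ K := Ideal.Quotient.liftₐ I (Algebra.ofId A (S ⧸ K)) fun a ha ↦
    Ideal.Quotient.eq_zero_iff_mem.2 (Ideal.mem_map_of_mem (algebraMap A S) ha)
  let τ : S ⧸ K →ₐ[A] A ⧸ I := Ideal.Quotient.liftₐ K σ fun s hs ↦ hK hs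
  let ψ := Algebra.TensorProduct.productMap (Ideal.Quotient.mkₐ A K) (ι.comp σ)
  obtain ⟨b, hb⟩ := Ideal.Quotient.mk_surjective (ψ (Algebra.FormallyUnramified.elem A S))
  have hτι : ∀ x, τ (ι x) = x := fun x ↦ by
    obtain ⟨a, rfl⟩ := Ideal.Quotient.mk_surjective x
    change τ (ι (algebraMap A (A ⧸ I) a)) = algebraMap A (A ⧸ I) a
    rw [AlgHom.commutes, AlgHom.commutes]
  refine ⟨b, ?_, fun s a hsa ↦ ?_⟩
  · have hτψ : τ.comp ψ = σ.comp (Algebra.TensorProduct.lmul' A) := by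
      ext s
      · simp [ψ, τ]
        rfl
      · simp [ψ, hτι]
    calc σ b = τ (Ideal.Quotient.mk K b) := rfl
      _ = (τ.comp ψ) (Algebra.FormallyUnramified.elem A S) := by rw [hb]; rfl
      _ = 1 := by
        rw [hτψ, AlgHom.comp_apply, Algebra.FormallyUnramified.lmul_elem, map_one]
  · have h := congrArg ψ (Algebra.FormallyUnramified.one_tmul_sub_tmul_one_mul_elem (R := A) s)
    rw [map_mul, map_sub, map_zero, ← hb] at h
    have hs : ι (σ s) = Ideal.Quotient.mk K (algebraMap A S a) := by rw [hsa]; rfl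
    simp only [ψ, Algebra.TensorProduct.productMap_apply_tmul, map_one, one_mul, mul_one,
      AlgHom.comp_apply, hs, Ideal.Quotient.mkₐ_eq_mk] at h
    rw [← map_sub, ← map_mul, Ideal.Quotient.eq_zero_iff_mem] at h
    rw [← neg_mem_iff]
    convert h using 1
    ring

lemma mul_mem_smul_top {B : Type*} [CommRing B] [Algebra A B] (c : B) {z : B}
    (hz : z ∈ I • (⊤ : Submodule A B)) : c * z ∈ I • (⊤ : Submodule A B) := by
  have h := Submodule.mem_map_of_mem (f := LinearMap.mulLeft A c) hz
  rw [Submodule.map_smul''] at h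
  exact Submodule.smul_mono le_rfl le_top h

lemma exists_finite_subalgebra {S : Type*} [CommRing S] [Algebra A S]
    [Algebra.FiniteType A S] [Algebra.FormallyUnramified A S] (σ : S →ₐ[A] A ⧸ I) :
    ∃ (B : Subalgebra A S) (g b : B), Module.Finite A B ∧ σ g = 1 ∧ σ b = 1 ∧
      (∀ s : S, ∃ n, (g : S) ^ n * s ∈ B) ∧
      ∀ (y : B) (a : A), σ y = Ideal.Quotient.mk I a →
        b * (y - algebraMap A B a) ∈ I • (⊤ : Submodule A B) := by
  obtain ⟨g, hg₁, hg, hgs⟩ := exists_isIntegral_pow_mul σ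
  obtain ⟨b₀, hb₀, hb₀s⟩ := exists_mul_sub_mem_map σ
  obtain ⟨T, hT⟩ := Algebra.FiniteType.out (R := A) (A := S)
  choose n hn using hgs
  let U : Set S := insert g ((fun t ↦ g ^ n t * t) '' (insert b₀ (T : Set S)))
  let B : Subalgebra A S := Algebra.adjoin A U
  have hBfin : Module.Finite A B := by
    refine Module.Finite.iff_fg.2 (fg_adjoin_of_finite ?_ ?_)
    · exact ((T.finite_toSet.insert b₀).image _).insert g
    · rintro _ (rfl | ⟨t, -, rfl⟩)
      exacts [hg, hn t]
  have hgB : g ∈ B := Algebra.subset_adjoin (Set.mem_insert _ _)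
  have hbB : g ^ n b₀ * b₀ ∈ B :=
    Algebra.subset_adjoin (Set.mem_insert_of_mem _ ⟨b₀, Set.mem_insert _ _, rfl⟩)
  have hsB : ∀ s : S, ∃ m, g ^ m * s ∈ B := by
    intro s
    have hs : s ∈ Algebra.adjoin A (T : Set S) := hT ▸ Algebra.mem_top
    induction hs using Algebra.adjoin_induction with
    | mem s hs =>
      exact ⟨n s, Algebra.subset_adjoin
        (Set.mem_insert_of_mem _ ⟨s, Set.mem_insert_of_mem _ hs, rfl⟩)⟩
    | algebraMap r => exact ⟨0, by simp⟩
    | add x y _ _ hx hy =>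
      obtain ⟨k, hk⟩ := hx
      obtain ⟨l, hl⟩ := hy
      refine ⟨k + l, ?_⟩
      have : g ^ (k + l) * (x + y) = g ^ l * (g ^ k * x) + g ^ k * (g ^ l * y) := by ring
      rw [this]
      exact add_mem (mul_mem (pow_mem hgB _) hk) (mul_mem (pow_mem hgB _) hl)
    | mul x y _ _ hx hy =>
      obtain ⟨k, hk⟩ := hx
      obtain ⟨l, hl⟩ := hy
      refine ⟨k + l, ?_⟩
      have : g ^ (k + l) * (x * y) = (g ^ k * x) * (g ^ l * y) := by ring
      rw [this]
      exact mul_mem hk hl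
  let g' : B := ⟨g, hgB⟩
  have hIB : ∀ x ∈ I.map (algebraMap A S), ∃ m, ∃ z ∈ I • (⊤ : Submodule A B),
      (z : S) = g ^ m * x := by
    intro x hx
    rw [Ideal.map] at hx
    induction hx using Submodule.span_induction with
    | mem x hx =>
      obtain ⟨a, ha, rfl⟩ := hx
      exact ⟨0, a • 1, Submodule.smul_mem_smul ha trivial, by simp [Algebra.smul_def]⟩
    | zero => exact ⟨0, 0, zero_mem _, by simp⟩
    | add x y _ _ hx hy =>
      obtain ⟨k, z, hz, hzx⟩ := hx
      obtain ⟨l, w, hw, hwy⟩ := hy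
      refine ⟨k + l, g' ^ l * z + g' ^ k * w, add_mem ?_ ?_, ?_⟩
      · exact mul_mem_smul_top _ hz
      · exact mul_mem_smul_top _ hw
      · push_cast
        rw [hzx, hwy]
        ring
    | smul c x _ hx =>
      obtain ⟨k, z, hz, hzx⟩ := hx
      obtain ⟨l, hl⟩ := hsB c
      refine ⟨k + l, ⟨_, hl⟩ * z, mul_mem_smul_top _ hz, ?_⟩
      push_cast
      rw [hzx, smul_eq_mul]
      ring
  obtain ⟨k, y, hy⟩ := Module.Finite.exists_fin (R := A) (M := B)
  have hm : ∀ j, ∃ m : ℕ, ∃ a, σ (y j) = Ideal.Quotient.mk I a ∧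
      g' ^ m * (⟨_, hbB⟩ * (y j - algebraMap A B a)) ∈ I • (⊤ : Submodule A B) := by
    intro j
    obtain ⟨a, ha⟩ := Ideal.Quotient.mk_surjective (σ (y j))
    obtain ⟨m, z, hz, hzx⟩ := hIB _ (Ideal.mul_mem_left _ (g ^ n b₀) (hb₀s _ a ha.symm))
    refine ⟨m, a, ha.symm, ?_⟩
    convert hz
    ext
    rw [hzx]
    push_cast
    simp [g', mul_assoc]
  choose m a ha hma using hm
  let b : B := g' ^ (∑ j, m j) * ⟨_, hbB⟩
  have hσb : σ b = 1 := by simp [b, g', hg₁, hb₀]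
  refine ⟨B, g', b, hBfin, hg₁, hσb, hsB, ?_⟩
  have hex : ∀ x : B, ∃ c, σ x = Ideal.Quotient.mk I c ∧
      b * (x - algebraMap A B c) ∈ I • (⊤ : Submodule A B) := by
    intro x
    have hx : x ∈ Submodule.span A (Set.range y) := hy ▸ Submodule.mem_top
    induction hx using Submodule.span_induction with
    | mem x hx =>
      obtain ⟨j, rfl⟩ := hx
      refine ⟨a j, ha j, ?_⟩
      have : b * (y j - algebraMap A B (a j)) = g' ^ (∑ j, m j - m j) *
          (g' ^ m j * (⟨_, hbB⟩ * (y j - algebraMap A B (a j)))) := by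
        rw [← mul_assoc, ← mul_assoc, ← pow_add, Nat.sub_add_cancel
          (Finset.single_le_sum (fun _ _ ↦ Nat.zero_le _) (Finset.mem_univ j))]
      rw [this]
      exact mul_mem_smul_top _ (hma j)
    | zero => exact ⟨0, by simp, by simp⟩
    | add x z _ _ hx hz =>
      obtain ⟨c, hc, hcx⟩ := hx
      obtain ⟨d, hd, hdz⟩ := hz
      refine ⟨c + d, by simp [hc, hd], ?_⟩
      rw [map_add, add_sub_add_comm, mul_add]
      exact add_mem hcx hdz
    | smul r x _ hx =>
      obtain ⟨c, hc, hcx⟩ := hx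
      refine ⟨r * c, ?_, ?_⟩
      · simp [hc, Algebra.smul_def]
      · rw [map_mul, ← Algebra.smul_def, ← smul_sub, mul_smul_comm]
        exact Submodule.smul_mem _ _ hcx
  intro x c hc
  obtain ⟨d, hd, hdx⟩ := hex x
  have hcd : d - c ∈ I := Ideal.Quotient.eq.1 (hd.symm.trans hc)
  have : b * (x - algebraMap A B c) = b * (x - algebraMap A B d) + (d - c) • b := by
    rw [Algebra.smul_def, map_sub]; ring
  rw [this]
  exact add_mem hdx (Submodule.smul_mem_smul hcd trivial)

/-- Sections modulo `I` of étale algebras lift along Henselian pairs. -/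
theorem exists_lift_of_etale [HenselianRing A I] {S : Type*} [CommRing S] [Algebra A S]
    [Algebra.Etale A S] (σ : S →ₐ[A] A ⧸ I) :
    ∃ τ : S →ₐ[A] A, (Ideal.Quotient.mkₐ A I).comp τ = σ := by
  obtain ⟨B, g, b, _, hg, hb, hgs, hby⟩ := exists_finite_subalgebra σ
  obtain ⟨e, he, hσe, hey⟩ := exists_isIdempotentElem (σ.comp B.val) b hb hby
  have he' : (e : S) * e = e := congrArg Subtype.val he
  have hσe' : σ (e : S) = 1 := hσe
  have hmk : ∀ (a : A) (s : S), e * s = a • (e : S) → σ s = Ideal.Quotient.mk I a := by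
    intro a s h
    have := congrArg σ h
    rw [map_mul, map_smul, hσe', one_mul, Algebra.smul_def, mul_one] at this
    exact this
  obtain ⟨v, hv⟩ := hey g
  have hv' : (e : S) * g = v • (e : S) := congrArg Subtype.val hv
  have hvu : IsUnit v := by
    refine isUnit_of_sub_one_mem (I := I) (Ideal.Quotient.eq.1 ?_)
    rw [← hmk v g hv', hg, map_one]
  have hpow : ∀ n : ℕ, (e : S) * (g : S) ^ n = v ^ n • (e : S) := by
    intro n
    induction n with
    | zero => simp
    | succ n ih => rw [pow_succ, ← mul_assoc, ih, smul_mul_assoc, hv', smul_smul, ← pow_succ]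
  have hes : ∀ s : S, ∃ a : A, (e : S) * s = a • (e : S) := by
    intro s
    obtain ⟨n, hn⟩ := hgs s
    obtain ⟨a, ha⟩ := hey ⟨_, hn⟩
    have ha' : (e : S) * ((g : S) ^ n * s) = a • (e : S) := congrArg Subtype.val ha
    obtain ⟨w, hw⟩ := hvu.pow n
    refine ⟨↑w⁻¹ * a, ?_⟩
    rw [mul_smul, ← ha', ← mul_assoc, hpow, ← hw, smul_mul_assoc, smul_smul, Units.inv_mul,
      one_smul]
  have hinj : ∀ a : A, a • (e : S) = 0 → a = 0 := by
    intro a ha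
    obtain ⟨k, c, y, hy, hac⟩ := Module.Flat.isTrivialRelation_of_sum_smul_eq_zero
      (ι := Unit) (f := fun _ ↦ a) (x := fun _ ↦ (e : S)) (by simpa using ha)
    choose d hd using fun j ↦ hes (y j)
    have hsum : (e : S) * e = (∑ j, c () j * d j) • (e : S) := by
      rw [show (e : S) * e = e * ∑ j, c () j • y j from congrArg (_ * ·) (hy ()),
        Finset.mul_sum, Finset.sum_smul]
      refine Finset.sum_congr rfl fun j _ ↦ ?_
      rw [mul_smul_comm, hd, smul_smul]
    have hunit : IsUnit (∑ j, c () j * d j) := by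
      refine isUnit_of_sub_one_mem (I := I) (Ideal.Quotient.eq.1 ?_)
      rw [← hmk _ _ hsum, hσe', map_one]
    refine hunit.mul_left_eq_zero.1 ?_
    rw [Finset.mul_sum]
    refine Finset.sum_eq_zero fun j _ ↦ ?_
    have := hac j
    rw [Fintype.sum_unique] at this
    rw [← mul_assoc]
    exact mul_eq_zero_of_left this _
  have heq : ∀ a a' : A, a • (e : S) = a' • (e : S) → a = a' := fun a a' h ↦
    sub_eq_zero.1 (hinj _ (by rw [sub_smul, h, sub_self]))
  choose τ hτ using hes
  refine ⟨AlgHom.ofLinearMap ⟨⟨τ, ?_⟩, ?_⟩ ?_ ?_, ?_⟩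
  · intro s t
    refine heq _ _ ?_
    rw [← hτ, add_smul, ← hτ, ← hτ, mul_add]
  · intro a s
    refine heq _ _ ?_
    rw [← hτ, RingHom.id_apply, smul_assoc, ← hτ, mul_smul_comm]
  · refine heq _ _ ?_
    change τ 1 • (e : S) = _
    rw [← hτ, mul_one, one_smul]
  · intro s t
    refine heq _ _ ?_
    change τ (s * t) • (e : S) = (τ s * τ t) • (e : S)
    rw [← hτ, mul_smul, ← hτ t, ← mul_smul_comm, ← mul_assoc, hτ s, smul_mul_assoc, mul_smul_comm]
  · ext s
    exact (hmk _ _ (hτ s)).symm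

/-- The standard smooth algebra of relative dimension zero obtained from a square system of
polynomial equations by inverting its Jacobian is étale. -/
lemma etale_localizationAway_jacobian {σ : Type*} [Finite σ] (G : σ → MvPolynomial σ A) :
    Algebra.Etale A (Localization.Away
      (Algebra.PreSubmersivePresentation.naive (v := G) id Function.injective_id).jacobian) := by
  let P := Algebra.PreSubmersivePresentation.naive (v := G) id Function.injective_id
  let Q := Algebra.PreSubmersivePresentation.localizationAway
    (Localization.Away P.jacobian) P.jacobian
  let T : Algebra.SubmersivePresentation A (Localization.Away P.jacobian) (Unit ⊕ σ) (Unit ⊕ σ) :=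
    { Q.comp P with
      jacobian_isUnit := by
        change IsUnit (Q.comp P).jacobian
        have h : IsUnit (algebraMap _ (Localization.Away P.jacobian) P.jacobian) :=
          IsLocalization.Away.algebraMap_isUnit _
        rw [Algebra.PreSubmersivePresentation.comp_jacobian_eq_jacobian_smul_jacobian,
          Algebra.smul_def, Algebra.PreSubmersivePresentation.localizationAway_jacobian]
        exact h.mul h }
  have : Algebra.IsStandardSmoothOfRelativeDimension 0 A (Localization.Away P.jacobian) :=
    T.isStandardSmoothOfRelativeDimension (by simp [Algebra.Presentation.dimension])
  infer_instance

lemma exists_algHom_localizationAway {S T : Type*} [CommRing S] [CommRing T] [Algebra A S]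
    [Algebra A T] (f : S →ₐ[A] T) {r : S} (hr : IsUnit (f r)) :
    ∃ g : Localization.Away r →ₐ[A] T, ∀ s, g (algebraMap S _ s) = f s :=
  ⟨{ IsLocalization.Away.lift r (g := f.toRingHom) hr with
      commutes' := fun a ↦ by
        change IsLocalization.Away.lift r (g := f.toRingHom) hr _ = _
        rw [IsScalarTower.algebraMap_apply A S, IsLocalization.Away.lift_eq]
        exact f.commutes a },
    fun s ↦ IsLocalization.Away.lift_eq r (g := f.toRingHom) hr s⟩

/-- The multivariate Hensel lemma for Henselian pairs. -/
theorem exists_eval_eq_zero [HenselianRing A I] {σ : Type*} [Fintype σ] [DecidableEq σ]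
    (G : σ → MvPolynomial σ A) (a : σ → A) (ha : ∀ j, MvPolynomial.eval a (G j) ∈ I)
    (hdet : IsUnit (Matrix.of fun i j ↦ MvPolynomial.eval a ((G j).pderiv i)).det) :
    ∃ y : σ → A, (∀ i, y i - a i ∈ I) ∧ ∀ j, MvPolynomial.eval y (G j) = 0 := by
  let P := Algebra.PreSubmersivePresentation.naive (v := G) id Function.injective_id
  have := etale_localizationAway_jacobian G
  let φ : MvPolynomial σ A →ₐ[A] A ⧸ I := (Ideal.Quotient.mkₐ A I).comp (MvPolynomial.aeval a)
  have hφ : Ideal.span (Set.range G) ≤ RingHom.ker φ := by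
    rw [Ideal.span_le]
    rintro _ ⟨j, rfl⟩
    exact Ideal.Quotient.eq_zero_iff_mem.2 (ha j)
  let ψ : (MvPolynomial σ A ⧸ Ideal.span (Set.range G)) →ₐ[A] A ⧸ I :=
    Ideal.Quotient.liftₐ _ φ fun p hp ↦ hφ hp
  have hψ : ∀ p, ψ (Ideal.Quotient.mk _ p) = Ideal.Quotient.mk I (MvPolynomial.eval a p) :=
    fun p ↦ rfl
  have hu : IsUnit (ψ P.jacobian) := by
    have : P.jacobian = Ideal.Quotient.mk _ P.jacobiMatrix.det := by
      rw [P.jacobian_eq_jacobiMatrix_det]; rfl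
    rw [this, hψ, RingHom.map_det]
    refine IsUnit.map _ ?_
    convert hdet using 2
    ext i j
    simp [P]
  obtain ⟨θ, hθ⟩ := exists_algHom_localizationAway ψ hu
  obtain ⟨τ, hτ⟩ := exists_lift_of_etale θ
  let κ : MvPolynomial σ A →ₐ[A] Localization.Away P.jacobian :=
    (IsScalarTower.toAlgHom A (MvPolynomial σ A ⧸ Ideal.span (Set.range G)) _).comp
      (Ideal.Quotient.mkₐ A _)
  have hκ : ∀ p, MvPolynomial.eval (fun i ↦ τ (κ (MvPolynomial.X i))) p = τ (κ p) := by
    intro p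
    rw [← MvPolynomial.coe_aeval_eq_eval]
    exact DFunLike.congr_fun (MvPolynomial.algHom_ext (f := MvPolynomial.aeval _)
      (g := τ.comp κ) (fun i ↦ by simp)) p
  refine ⟨fun i ↦ τ (κ (MvPolynomial.X i)), fun i ↦ ?_, fun j ↦ ?_⟩
  · rw [← Ideal.Quotient.eq]
    refine (DFunLike.congr_fun hτ (κ (MvPolynomial.X i))).trans ?_
    refine (hθ _).trans ((hψ _).trans ?_)
    rw [MvPolynomial.eval_X]
  · rw [hκ]
    have : Ideal.Quotient.mkₐ A (Ideal.span (Set.range G)) (G j) = 0 :=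
      Ideal.Quotient.eq_zero_iff_mem.2 (Ideal.subset_span ⟨j, rfl⟩)
    simp [κ]

/-- Sections modulo `I` of smooth algebras lift along Henselian pairs. -/
theorem exists_lift_of_smooth [HenselianRing A I] {R S : Type*} [CommRing R] [CommRing S]
    [Algebra R A] [Algebra R S] [Algebra.Smooth R S] (σ : S →ₐ[R] A ⧸ I) :
    ∃ τ : S →ₐ[R] A, (Ideal.Quotient.mkₐ R I).comp τ = σ := by
  classical
  obtain ⟨n, π, hπ, hfg⟩ := Algebra.FinitePresentation.out (R := R) (A := S)
  obtain ⟨m, f, hf⟩ := Submodule.fg_iff_exists_fin_generating_family.1 hfg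
  replace hf : Ideal.span (Set.range f) = RingHom.ker π := hf
  obtain ⟨D, q, hqD, hqf, hqq⟩ := MvPolynomial.exists_matrix_of_formallySmooth π hπ f hf
  choose a ha using fun i ↦ Ideal.Quotient.mk_surjective (σ (π (MvPolynomial.X i)))
  have haev : ∀ p, Ideal.Quotient.mk I (MvPolynomial.aeval a p) = σ (π p) := fun p ↦
    DFunLike.congr_fun (MvPolynomial.algHom_ext
      (f := (Ideal.Quotient.mkₐ R I).comp (MvPolynomial.aeval a)) (g := σ.comp π)
      (fun i ↦ by simp [ha])) p
  obtain ⟨c, hc⟩ : ∃ c : Fin n → Fin m → A, ∀ i k, c i k = MvPolynomial.aeval a (D i k) :=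
    ⟨_, fun _ _ ↦ rfl⟩
  obtain ⟨o, ho⟩ : ∃ o : Fin m → A, ∀ k, o k = 0 := ⟨0, fun _ ↦ rfl⟩
  let x : Fin n → MvPolynomial (Fin m) A := fun i ↦
    MvPolynomial.C (a i) - ∑ k, MvPolynomial.C (c i k) * MvPolynomial.X k
  let Φ : MvPolynomial (Fin n) R →ₐ[R] MvPolynomial (Fin m) A := MvPolynomial.aeval x
  have hΦ : ∀ y p, MvPolynomial.eval y (Φ p) =
      MvPolynomial.aeval (fun i ↦ MvPolynomial.eval y (x i)) p := fun y p ↦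
    DFunLike.congr_fun (MvPolynomial.algHom_ext
      (f := ((MvPolynomial.aeval y).restrictScalars R).comp Φ)
      (g := MvPolynomial.aeval fun i ↦ MvPolynomial.eval y (x i))
      (fun i ↦ by simp [Φ])) p
  have hx₀ : (fun i ↦ MvPolynomial.eval o (x i)) = a := by
    ext i
    simp [x, ho]
  have hdx : ∀ i k, MvPolynomial.pderiv k (x i) =
      -MvPolynomial.C (c i k) := by
    intro i k
    simp [x, MvPolynomial.pderiv_X, Pi.single_apply]
  let G : Fin m → MvPolynomial (Fin m) A := fun j ↦
    Φ (f j) + (MvPolynomial.X j + ∑ k, Φ (q j k) * MvPolynomial.X k)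
  have hG₀ : ∀ j k, MvPolynomial.eval o ((G j).pderiv k) = (1 : Matrix _ _ A) k j := by
    intro j k
    have h : MvPolynomial.pderiv k (Φ (f j)) =
        ∑ i, Φ (MvPolynomial.pderiv i (f j)) * MvPolynomial.pderiv k (x i) :=
      MvPolynomial.derivation_aeval ((MvPolynomial.pderiv k).restrictScalars R) x (f j)
    simp [G, h, hdx, ← hc, ho, eq_comm (a := k), hΦ, hx₀, hqD, MvPolynomial.pderiv_X,
      Pi.single_apply, Matrix.one_apply, Finset.sum_add_distrib]
  obtain ⟨y, hy, hyG⟩ := exists_eval_eq_zero (I := I) G o (fun j ↦ by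
    rw [← Ideal.Quotient.eq_zero_iff_mem]
    have hfj : π (f j) = 0 := (hf ▸ Ideal.subset_span ⟨j, rfl⟩ : f j ∈ RingHom.ker π)
    simp [G, hΦ, hx₀, haev, hfj, ho]) (by
    rw [show (Matrix.of fun i j ↦ MvPolynomial.eval o ((G j).pderiv i)) = 1 from
      Matrix.ext fun i j ↦ hG₀ j i, Matrix.det_one]
    exact isUnit_one)
  have hyI : ∀ i, y i ∈ I := fun i ↦ by simpa [ho] using hy i
  let z : Fin n → A := fun i ↦ MvPolynomial.eval y (x i)
  let ev : MvPolynomial (Fin n) R →ₐ[R] A := MvPolynomial.aeval z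
  have hza : ∀ i, Ideal.Quotient.mk I (z i) = Ideal.Quotient.mk I (a i) := by
    intro i
    have : ∀ k, Ideal.Quotient.mk I (y k) = 0 := fun k ↦
      Ideal.Quotient.eq_zero_iff_mem.2 (hyI k)
    simp [z, x, this]
  have hev : ∀ p, Ideal.Quotient.mk I (ev p) = σ (π p) := fun p ↦
    DFunLike.congr_fun (MvPolynomial.algHom_ext
      (f := (Ideal.Quotient.mkₐ R I).comp ev) (g := σ.comp π)
      (fun i ↦ by simp [ev, hza, ha])) p
  let N : Ideal A := Ideal.span (Set.range fun j ↦ ev (f j))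
  have hKN : ∀ p ∈ RingHom.ker π, ev p ∈ N := by
    intro p hp
    rw [← hf] at hp
    have := Ideal.mem_map_of_mem ev hp
    rwa [Ideal.map_span, ← Set.range_comp] at this
  have hKI : ∀ p ∈ RingHom.ker π, ev p ∈ I := fun p hp ↦ by
    rw [← Ideal.Quotient.eq_zero_iff_mem, hev, RingHom.mem_ker.1 hp, map_zero]
  have hKN₂ : ∀ p ∈ RingHom.ker π ^ 2, ev p ∈ I • N := by
    intro p hp
    rw [pow_two] at hp
    induction hp using Submodule.mul_induction_on' with
    | mem_mul_mem s hs t ht =>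
      rw [map_mul]
      exact Ideal.mul_mem_mul (hKI s hs) (hKN t ht)
    | add s _ t _ hs ht => rw [map_add]; exact add_mem hs ht
  have hfy : ∀ j, ev (f j) = -(y j + ∑ k, ev (q j k) * y k) := by
    intro j
    have h := hyG j
    simp only [G, map_add, map_sum, map_mul, hΦ, MvPolynomial.eval_X] at h
    exact eq_neg_of_add_eq_zero_left h
  have hN : N = ⊥ := by
    refine Submodule.eq_bot_of_le_smul_of_le_jacobson_bot I N
      (Submodule.fg_span (Set.finite_range _)) ?_ HenselianRing.jac
    rw [Ideal.span_le]
    rintro _ ⟨j, rfl⟩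
    have h₁ : ∑ k, ev (q j k) * ev (f k) =
        -∑ k, y k * ev (q j k + ∑ l, q j l * q l k) := by
      simp_rw [hfy, mul_neg, Finset.sum_neg_distrib, map_add, map_sum, map_mul, mul_add,
        Finset.sum_add_distrib, Finset.mul_sum]
      rw [Finset.sum_comm (f := fun i k ↦ _ * (_ * _))]
      congr 2
      · exact Finset.sum_congr rfl fun _ _ ↦ mul_comm _ _
      · exact Finset.sum_congr rfl fun _ _ ↦ Finset.sum_congr rfl fun _ _ ↦ by ring
    have h₂ : ev (f j) = ev (f j + ∑ k, q j k * f k) +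
        ∑ k, y k * ev (q j k + ∑ l, q j l * q l k) := by
      rw [map_add, map_sum]
      simp_rw [map_mul]
      rw [h₁, neg_add_cancel_right]
    simp only [SetLike.mem_coe]
    rw [h₂]
    exact add_mem (hKN₂ _ (hqf j)) (sum_mem fun k _ ↦ Ideal.mul_mem_mul (hyI k) (hKN _ (hqq j k)))
  have hker : ∀ p ∈ RingHom.ker π, ev p = 0 := fun p hp ↦ by
    simpa [hN] using hKN p hp
  refine ⟨(Ideal.Quotient.liftₐ _ ev hker).comp
    (Ideal.quotientKerAlgEquivOfSurjective hπ).symm.toAlgHom, ?_⟩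
  ext s
  obtain ⟨p, rfl⟩ := hπ s
  have h : (Ideal.quotientKerAlgEquivOfSurjective hπ).symm (π p) = Ideal.Quotient.mk _ p := by
    rw [AlgEquiv.symm_apply_eq]
    rfl
  rw [← hev p]
  change Ideal.Quotient.mk I (Ideal.Quotient.liftₐ _ ev hker
    ((Ideal.quotientKerAlgEquivOfSurjective hπ).symm (π p))) = _
  rw [h]
  rfl

end HenselianRing

/-- Let `H` be an affine smooth group scheme over `R`, encoded by its
smooth Hopf coordinate ring `OH` together with the (functorial) group structure on
its points `H(B) = OH →ₐ[R] B`, and let `P ⊆ H` be a closed subgroup, encoded by a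
surjective map `π : OH → OP` of Hopf algebras, the points of `P` being the subgroups
`PI ⊆ H(A/I)`, `PJ ⊆ H(A/J)` given by composition with `π`.  Let `I ⊆ J` be ideals
of an `R`-algebra `A` with `(A, I)` Henselian.  Then reduction mod `I` induces a
bijection
`(H(A) ×_{H(A/J)} P(A/J)) / (H(A) ×_{H(A/I)} P(A/I)) ≅ (H(A/I) ×_{H(A/J)} P(A/J)) / P(A/I)`. -/
theorem fiber_product_quotient_bijection_of_henselian
    (R A OH OP : Type u) [CommRing R] [CommRing A] [Algebra R A]
    [CommRing OH] [Algebra R OH] [Algebra.Smooth R OH] [HopfAlgebra R OH]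
    [CommRing OP] [Algebra R OP] [HopfAlgebra R OP]
    (I J : Ideal A) (hIJ : I ≤ J) [HenselianRing A I]
    -- the group structure on points of `H`
    [Group (OH →ₐ[R] A)] [Group (OH →ₐ[R] A ⧸ I)] [Group (OH →ₐ[R] A ⧸ J)]
    -- functoriality of the group structure on points along `A → A/I → A/J`
    (ρI : (OH →ₐ[R] A) →* (OH →ₐ[R] A ⧸ I))
    (ρJ : (OH →ₐ[R] A) →* (OH →ₐ[R] A ⧸ J))
    (ρIJ : (OH →ₐ[R] A ⧸ I) →* (OH →ₐ[R] A ⧸ J))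
    (hρI : ∀ g : OH →ₐ[R] A, ρI g = (Ideal.Quotient.mkₐ R I).comp g)
    (hρJ : ∀ g : OH →ₐ[R] A, ρJ g = (Ideal.Quotient.mkₐ R J).comp g)
    (hρIJ : ∀ g : OH →ₐ[R] A ⧸ I, ρIJ g =
      (Ideal.quotientMapₐ J (AlgHom.id R A) (by simpa using hIJ)).comp g)
    (hρ : ∀ g : OH →ₐ[R] A, ρIJ (ρI g) = ρJ g)
    -- the closed subgroup `P`, with points cut out by composition with `π`
    (π : OH →ₐ[R] OP) (hπ : Function.Surjective π)
    (PI : Subgroup (OH →ₐ[R] A ⧸ I)) (PJ : Subgroup (OH →ₐ[R] A ⧸ J))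
    (hPI : (PI : Set (OH →ₐ[R] A ⧸ I)) =
      Set.range (fun ψ : OP →ₐ[R] A ⧸ I => ψ.comp π))
    (hPJ : (PJ : Set (OH →ₐ[R] A ⧸ J)) =
      Set.range (fun ψ : OP →ₐ[R] A ⧸ J => ψ.comp π)) :
    ∃ e : (PJ.comap ρJ) ⧸ ((PI.comap ρI).subgroupOf (PJ.comap ρJ)) ≃
        (PJ.comap ρIJ) ⧸ (PI.subgroupOf (PJ.comap ρIJ)),
      ∀ (g : OH →ₐ[R] A) (hg : g ∈ PJ.comap ρJ),
        e (QuotientGroup.mk ⟨g, hg⟩) =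
          QuotientGroup.mk ⟨ρI g, by
            simp only [Subgroup.mem_comap] at hg ⊢
            rw [hρ g]; exact hg⟩ := by
  have hsurj : Function.Surjective ρI := fun g ↦ by
    obtain ⟨τ, hτ⟩ := HenselianRing.exists_lift_of_smooth g
    exact ⟨τ, (hρI τ).trans hτ⟩
  let f : PJ.comap ρJ →* PJ.comap ρIJ :=
    (ρI.comp (PJ.comap ρJ).subtype).codRestrict _ fun g ↦ by
      have := g.2
      rw [Subgroup.mem_comap] at this ⊢
      exact (hρ g).symm ▸ this
  have hf : Function.Surjective f := by
    rintro ⟨y, hy⟩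
    obtain ⟨g, rfl⟩ := hsurj y
    exact ⟨⟨g, by rw [Subgroup.mem_comap, hρ] at hy; exact hy⟩, rfl⟩
  obtain ⟨e, he⟩ := Subgroup.exists_equiv_quotient_of_surjective f hf
    ((PI.comap ρI).subgroupOf (PJ.comap ρJ)) (PI.subgroupOf (PJ.comap ρIJ)) rfl
  exact ⟨e, fun g hg ↦ he ⟨g, hg⟩⟩
end
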